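/- arXiv:1104.3237 — 2 statements merged into one kernel-verified Lean document; each statement's English description precedes it below -/
import Mathlib

section
/- Let (ν_n) be a sequence of probability measures on ℤ such that for all n: (1) E(ν_n) = 0; (2) m₁(ν_n) ≤ a for a fixed constant a > 0; (3) ν_n(βℤ + r) ≤ ρ for a fixed constant ρ < 1, for every β ∈ ℤ with |β| ≠ 1 and every r ∈ ℤ; and (4) φ(n) = ∑_{i=1}^n m₂(ν_i) = O(n). Set μ_n = ν_1∗⋯∗ν_n. Then for every invertible measure-preserving transformation τ of a probability space (X, B, m) and every f ∈ L¹(X), the sequence μ_n f(x) = ∑_{k∈ℤ} μ_n(k) f(τ^k x) converges for almost every x ∈ X. -/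
open scoped BigOperators
open Filter MeasureTheory

/-- A probability measure on `ℤ`, given as a nonnegative function summing to `1`. -/
def IsProbMeasure (ν : ℤ → ℝ) : Prop := (∀ k, 0 ≤ ν k) ∧ HasSum ν 1

/-- The Fourier transform `ν̂(t) = ∑_{k ∈ ℤ} ν(k) e^{2πikt}`. -/
noncomputable def ft (ν : ℤ → ℝ) (t : ℝ) : ℂ :=
  ∑' k : ℤ, (ν k : ℂ) * Complex.exp (2 * Real.pi * Complex.I * (k : ℂ) * (t : ℂ))

/-- Convolution of two measures on `ℤ`. -/
noncomputable def conv (μ ν : ℤ → ℝ) (k : ℤ) : ℝ := ∑' j : ℤ, μ (k - j) * ν j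

/-- `muN ν n = ν 0 ∗ ν 1 ∗ ⋯ ∗ ν n`. -/
noncomputable def muN (ν : ℕ → ℤ → ℝ) : ℕ → ℤ → ℝ
  | 0 => ν 0
  | n + 1 => conv (muN ν n) (ν (n + 1))

/-- The expectation `E(ν) = ∑ k ν(k)`. -/
noncomputable def expectation (ν : ℤ → ℝ) : ℝ := ∑' k : ℤ, (k : ℝ) * ν k

/-- The second moment `m₂(ν)`. -/
noncomputable def m2 (ν : ℤ → ℝ) : ℝ := ∑' k : ℤ, |(k : ℝ)| ^ 2 * ν k

/-- The first moment `m₁(ν)`. -/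
noncomputable def m1 (ν : ℤ → ℝ) : ℝ := ∑' k : ℤ, |(k : ℝ)| * ν k

/-- `ν` is strictly aperiodic: its support is not contained in any proper coset `r + βℤ`. -/
def StrictlyAperiodic (ν : ℤ → ℝ) : Prop :=
  ∀ β r : ℤ, β.natAbs ≠ 1 → ∃ k : ℤ, ν k ≠ 0 ∧ ¬ β ∣ (k - r)

/-- The mass `ν(βℤ + r)` that `ν` gives to the coset `βℤ + r`. -/
noncomputable def cosetMass (ν : ℤ → ℝ) (β r : ℤ) : ℝ :=
  ∑' k : ℤ, if β ∣ (k - r) then ν k else 0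

section Aperiodic

theorem norm_exp_sub_one_sq (x : ℝ) :
    ‖Complex.exp (x * Complex.I) - 1‖ ^ 2 = 2 * (1 - Real.cos x) := by
  rw [← Complex.normSq_eq_norm_sq, Complex.normSq_apply]
  simp only [Complex.sub_re, Complex.sub_im, Complex.exp_ofReal_mul_I_re,
    Complex.exp_ofReal_mul_I_im, Complex.one_re, Complex.one_im]
  nlinarith [Real.sin_sq_add_cos_sq x]

theorem norm_exp_add_sub_one_le (x y : ℝ) :
    ‖Complex.exp ((x + y : ℝ) * Complex.I) - 1‖ ≤
      ‖Complex.exp (x * Complex.I) - 1‖ + ‖Complex.exp (y * Complex.I) - 1‖ := by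
  have h : Complex.exp ((x + y : ℝ) * Complex.I) - 1 =
      Complex.exp (y * Complex.I) * (Complex.exp (x * Complex.I) - 1) +
        (Complex.exp (y * Complex.I) - 1) := by
    push_cast
    rw [add_mul, Complex.exp_add]
    ring
  rw [h]
  refine (norm_add_le _ _).trans ?_
  rw [norm_mul, Complex.norm_exp_ofReal_mul_I, one_mul]

theorem norm_exp_neg_sub_one (x : ℝ) :
    ‖Complex.exp ((-x : ℝ) * Complex.I) - 1‖ = ‖Complex.exp (x * Complex.I) - 1‖ := by
  rw [← sq_eq_sq₀ (norm_nonneg _) (norm_nonneg _), norm_exp_sub_one_sq, norm_exp_sub_one_sq,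
    Real.cos_neg]

theorem le_norm_exp_sub_one {t : ℝ} (ht : |t| ≤ Real.pi) :
    2 / Real.pi * |t| ≤ ‖Complex.exp (t * Complex.I) - 1‖ := by
  have h1 : 2 / Real.pi * |t / 2| ≤ |Real.sin (t / 2)| :=
    Real.mul_abs_le_abs_sin (by rw [abs_div, abs_two]; linarith)
  refine le_of_sq_le_sq ?_ (norm_nonneg _)
  have h2 : Real.cos t = 1 - 2 * Real.sin (t / 2) ^ 2 := by
    have := Real.cos_two_mul (t / 2)
    rw [mul_div_cancel₀ t two_ne_zero] at this
    nlinarith [Real.sin_sq_add_cos_sq (t / 2)]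
  rw [norm_exp_sub_one_sq, h2]
  rw [abs_div, abs_two] at h1
  have h0 : 0 ≤ 2 / Real.pi * |t| := by positivity
  have h3 : 2 / Real.pi * |t| ≤ 2 * |Real.sin (t / 2)| := by linarith
  nlinarith [sq_abs (Real.sin (t / 2)), abs_nonneg (Real.sin (t / 2))]

/-- If `S` lies in no proper coset of `ℤ`, then the frequencies in `S` control `t`. -/
theorem exists_mul_sq_le_sum_one_sub_cos {S : Finset ℤ}
    (hS : ∀ β r : ℤ, β.natAbs ≠ 1 → ∃ s ∈ S, ¬β ∣ s - r) :
    ∃ c > 0, ∀ t θ : ℝ, |t| ≤ Real.pi → c * t ^ 2 ≤ ∑ s ∈ S, (1 - Real.cos (s * t - θ)) := by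
  set d : ℝ → ℝ := fun x => ‖Complex.exp (x * Complex.I) - 1‖ with hd
  have hd0 : ∀ x, 0 ≤ d x := fun x => norm_nonneg _
  let G : AddSubgroup ℤ :=
    { carrier := {n | ∃ C : ℝ, ∀ t θ : ℝ, d (n * t) ≤ C * ∑ s ∈ S, d (s * t - θ)}
      zero_mem' := ⟨0, fun t θ => by simp [hd]⟩
      add_mem' := by
        rintro n k ⟨C, hC⟩ ⟨D, hD⟩
        refine ⟨C + D, fun t θ => ?_⟩
        have := norm_exp_add_sub_one_le (n * t) (k * t)
        rw [Int.cast_add, add_mul, add_mul]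
        exact this.trans (add_le_add (hC t θ) (hD t θ))
      neg_mem' := by
        rintro n ⟨C, hC⟩
        refine ⟨C, fun t θ => ?_⟩
        rw [Int.cast_neg, neg_mul]
        exact (norm_exp_neg_sub_one _).trans_le (hC t θ) }
  obtain ⟨s₀, hs₀, -⟩ := hS 0 0 (by decide)
  have hdiff : ∀ s ∈ S, s - s₀ ∈ G := by
    intro s hs
    refine ⟨2, fun t θ => ?_⟩
    have h1 := norm_exp_add_sub_one_le (s * t - θ) (-(s₀ * t - θ))
    rw [norm_exp_neg_sub_one] at h1
    have h2 : d (s * t - θ) ≤ ∑ s ∈ S, d (s * t - θ) :=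
      Finset.single_le_sum (f := fun s : ℤ => d (s * t - θ)) (fun i _ => hd0 _) hs
    have h3 : d (s₀ * t - θ) ≤ ∑ s ∈ S, d (s * t - θ) :=
      Finset.single_le_sum (f := fun s : ℤ => d (s * t - θ)) (fun i _ => hd0 _) hs₀
    have h4 : ((s - s₀ : ℤ) : ℝ) * t = s * t - θ + -(s₀ * t - θ) := by push_cast; ring
    rw [h4]
    change d _ ≤ d _ + d _ at h1
    linarith
  obtain ⟨g, hg⟩ := Int.subgroup_cyclic G
  have hmem : ∀ n, n ∈ G ↔ g ∣ n := fun n => by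
    rw [hg, ← AddSubgroup.zmultiples_eq_closure, Int.mem_zmultiples_iff]
  have hg1 : g.natAbs = 1 := by
    by_contra hne
    obtain ⟨s, hs, hsd⟩ := hS g s₀ hne
    exact hsd ((hmem _).1 (hdiff s hs))
  have h1G : (1 : ℤ) ∈ G := (hmem 1).2 (Int.natAbs_dvd_natAbs.1 (by simp [hg1]))
  obtain ⟨C, hC⟩ := h1G
  have hD : 0 < (|C| + 1) ^ 2 * (S.card + 1) := by positivity
  refine ⟨(2 / Real.pi) ^ 2 / 2 / ((|C| + 1) ^ 2 * (S.card + 1)), by positivity,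
    fun t θ ht => ?_⟩
  have hsum0 : 0 ≤ ∑ s ∈ S, d (s * t - θ) := Finset.sum_nonneg fun i _ => hd0 _
  have h1 : 2 / Real.pi * |t| ≤ (|C| + 1) * ∑ s ∈ S, d (s * t - θ) := by
    have h := hC t θ
    rw [Int.cast_one, one_mul] at h
    refine (le_norm_exp_sub_one ht).trans (h.trans ?_)
    exact mul_le_mul_of_nonneg_right (by linarith [le_abs_self C]) hsum0
  have h2 : (2 / Real.pi * |t|) ^ 2 ≤ ((|C| + 1) * ∑ s ∈ S, d (s * t - θ)) ^ 2 :=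
    pow_le_pow_left₀ (by positivity) h1 2
  have h3 : (∑ s ∈ S, d (s * t - θ)) ^ 2 ≤
      S.card * (2 * ∑ s ∈ S, (1 - Real.cos (s * t - θ))) := by
    refine sq_sum_le_card_mul_sum_sq.trans (le_of_eq ?_)
    congr 1
    rw [Finset.mul_sum]
    exact Finset.sum_congr rfl fun s _ => norm_exp_sub_one_sq _
  have hcos : 0 ≤ ∑ s ∈ S, (1 - Real.cos (s * t - θ)) :=
    Finset.sum_nonneg fun s _ => by linarith [Real.cos_le_one (s * t - θ)]
  rw [div_mul_eq_mul_div, div_le_iff₀ hD]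
  rw [mul_pow, mul_pow, sq_abs] at h2
  have h4 : (|C| + 1) ^ 2 * (∑ s ∈ S, d (s * t - θ)) ^ 2 ≤
      (|C| + 1) ^ 2 * (S.card * (2 * ∑ s ∈ S, (1 - Real.cos (s * t - θ)))) :=
    mul_le_mul_of_nonneg_left h3 (by positivity)
  have h5 : 0 ≤ (|C| + 1) ^ 2 * ∑ s ∈ S, (1 - Real.cos (s * t - θ)) := by positivity
  linarith

theorem exists_uniform_mul_sq_le_sum_one_sub_cos (A : Finset ℤ) :
    ∃ c > 0, ∀ S ⊆ A, (∀ β r : ℤ, β.natAbs ≠ 1 → ∃ s ∈ S, ¬β ∣ s - r) →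
      ∀ t θ : ℝ, |t| ≤ Real.pi → c * t ^ 2 ≤ ∑ s ∈ S, (1 - Real.cos (s * t - θ)) := by
  have h : ∀ᶠ c in nhdsWithin (0 : ℝ) (Set.Ioi 0), ∀ S ∈ A.powerset,
      (∀ β r : ℤ, β.natAbs ≠ 1 → ∃ s ∈ S, ¬β ∣ s - r) →
      ∀ t θ : ℝ, |t| ≤ Real.pi → c * t ^ 2 ≤ ∑ s ∈ S, (1 - Real.cos (s * t - θ)) := by
    refine (eventually_all_finset _).2 fun S _ => ?_
    by_cases hS : ∀ β r : ℤ, β.natAbs ≠ 1 → ∃ s ∈ S, ¬β ∣ s - r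
    · obtain ⟨c, hc, hcS⟩ := exists_mul_sq_le_sum_one_sub_cos hS
      filter_upwards [Ioo_mem_nhdsGT hc] with c' hc' _ t θ ht
      exact (mul_le_mul_of_nonneg_right hc'.2.le (sq_nonneg t)).trans (hcS t θ ht)
    · exact Eventually.of_forall fun c h => absurd h hS
  obtain ⟨c, hc, hc0⟩ := (h.and self_mem_nhdsWithin).exists
  exact ⟨c, hc0, fun S hS => hc S (Finset.mem_powerset.2 hS)⟩

/-- A finite set carrying more than `ρ` of the mass of `μ` is contained in no proper coset. -/
theorem exists_not_dvd_of_lt_sum {μ : ℤ → ℝ} (hμ : IsProbMeasure μ) {ρ : ℝ}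
    (hcoset : ∀ β r : ℤ, β.natAbs ≠ 1 → cosetMass μ β r ≤ ρ) {S : Finset ℤ}
    (hS : ρ < ∑ k ∈ S, μ k) (β r : ℤ) (hβ : β.natAbs ≠ 1) : ∃ s ∈ S, ¬β ∣ s - r := by
  by_contra! h
  refine absurd (hcoset β r hβ) (not_le.2 (hS.trans_le ?_))
  have hsum : Summable fun k : ℤ => if β ∣ k - r then μ k else 0 :=
    Summable.of_nonneg_of_le (fun k => by split_ifs <;> simp [hμ.1 k])
      (fun k => by split_ifs <;> simp [hμ.1 k]) hμ.2.summable
  calc ∑ k ∈ S, μ k = ∑ k ∈ S, if β ∣ k - r then μ k else 0 :=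
        Finset.sum_congr rfl fun k hk => by rw [if_pos (h k hk)]
    _ ≤ cosetMass μ β r :=
        hsum.sum_le_tsum S fun k _ => by split_ifs <;> simp [hμ.1 k]

/-- Tightness coming from a first moment bound. -/
theorem one_sub_div_le_sum_Icc {μ : ℤ → ℝ} (hμ : IsProbMeasure μ) {a : ℝ}
    (hm1 : Summable fun k : ℤ => |(k : ℝ)| * μ k) (hm1a : m1 μ ≤ a) {R : ℕ} (hR : 0 < R) :
    1 - a / R ≤ ∑ k ∈ Finset.Icc (-(R : ℤ)) R, μ k := by
  have hR' : (0 : ℝ) < R := by exact_mod_cast hR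
  have hle : ∀ k : ℤ, μ k ≤
      (if k ∈ Finset.Icc (-(R : ℤ)) R then μ k else 0) + |(k : ℝ)| * μ k / R := by
    intro k
    have h0 : 0 ≤ |(k : ℝ)| * μ k / R :=
      div_nonneg (mul_nonneg (abs_nonneg _) (hμ.1 k)) hR'.le
    split_ifs with hk
    · linarith
    · rw [zero_add, le_div_iff₀ hR', mul_comm]
      refine mul_le_mul_of_nonneg_right ?_ (hμ.1 k)
      have : (R : ℤ) ≤ |k| := by
        rw [Finset.mem_Icc, ← abs_le] at hk
        omega
      exact_mod_cast this
  have hfin : HasSum (fun k : ℤ => if k ∈ Finset.Icc (-(R : ℤ)) R then μ k else 0)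
      (∑ k ∈ Finset.Icc (-(R : ℤ)) R, μ k) := by
    have := hasSum_sum_of_ne_finset_zero (L := .unconditional ℤ)
      (f := fun k : ℤ => if k ∈ Finset.Icc (-(R : ℤ)) R then μ k else 0)
      (s := Finset.Icc (-(R : ℤ)) R) fun k hk => if_neg hk
    rwa [Finset.sum_congr rfl fun k hk => if_pos hk] at this
  have h := hasSum_le hle hμ.2 (hfin.add (hm1.hasSum.div_const (R : ℝ)))
  have h' : (∑' k : ℤ, |(k : ℝ)| * μ k) / R ≤ a / R := by
    gcongr
    exact hm1a
  linarith

/-- Uniform Gaussian decay of characteristic functions for measures with bounded first moment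
and with mass at most `ρ < 1` on proper cosets. -/
theorem exists_norm_charSum_le (a ρ : ℝ) (ha : 0 < a) (hρ1 : ρ < 1) :
    ∃ c > 0, ∀ μ : ℤ → ℝ, IsProbMeasure μ → (Summable fun k : ℤ => |(k : ℝ)| * μ k) →
      m1 μ ≤ a → (∀ β r : ℤ, β.natAbs ≠ 1 → cosetMass μ β r ≤ ρ) →
      ∀ t : ℝ, |t| ≤ Real.pi →
        ‖∑' k : ℤ, (μ k : ℂ) * Complex.exp ((k * t : ℝ) * Complex.I)‖ ≤
          Real.exp (-c * t ^ 2) := by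
  obtain ⟨R, hR⟩ := exists_nat_gt (2 * a / (1 - ρ))
  have hρ : 0 < 1 - ρ := by linarith
  have hR' : (0 : ℝ) < R := lt_trans (by positivity) hR
  have hR0 : 0 < R := by exact_mod_cast hR'
  have haR : a / R < (1 - ρ) / 2 := by
    rw [div_lt_iff₀ hρ] at hR
    rw [div_lt_iff₀ hR']
    linarith
  set A : Finset ℤ := Finset.Icc (-(R : ℤ)) R with hA
  obtain ⟨c, hc, hcA⟩ := exists_uniform_mul_sq_le_sum_one_sub_cos A
  set δ : ℝ := (1 - ρ) / 2 / (A.card + 1) with hδdef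
  have hδ : 0 < δ := by positivity
  have hδA : A.card * δ ≤ (1 - ρ) / 2 := by
    have : (A.card + 1) * δ = (1 - ρ) / 2 := mul_div_cancel₀ _ (by positivity)
    linarith
  refine ⟨δ * c, by positivity, fun μ hμ hm1 hm1a hcoset t ht => ?_⟩
  set S : Finset ℤ := A.filter fun k => δ ≤ μ k with hSdef
  have hSsum : ρ < ∑ k ∈ S, μ k := by
    have h1 := one_sub_div_le_sum_Icc hμ hm1 hm1a hR0
    rw [← Finset.sum_filter_add_sum_filter_not _ (fun k => δ ≤ μ k)] at h1
    have h2 : ∑ k ∈ A.filter (fun k => ¬δ ≤ μ k), μ k ≤ A.card * δ := by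
      refine (Finset.sum_le_card_nsmul _ _ δ fun k hk =>
        (not_le.1 (Finset.mem_filter.1 hk).2).le).trans ?_
      rw [nsmul_eq_mul]
      gcongr
      exact Finset.filter_subset _ _
    linarith
  set z : ℂ := ∑' k : ℤ, (μ k : ℂ) * Complex.exp ((k * t : ℝ) * Complex.I) with hz
  set θ : ℝ := z.arg
  have hsz : Summable fun k : ℤ => (μ k : ℂ) * Complex.exp ((k * t : ℝ) * Complex.I) :=
    Summable.of_norm (by
      simpa only [norm_mul, Complex.norm_exp_ofReal_mul_I, mul_one, Complex.norm_real]
        using hμ.2.summable.norm)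
  have hcos : HasSum (fun k : ℤ => μ k * Real.cos (k * t - θ)) ‖z‖ := by
    have h1 := hsz.hasSum.mul_left (Complex.exp ((-θ : ℝ) * Complex.I))
    have h2 : Complex.exp ((-θ : ℝ) * Complex.I) * z = (‖z‖ : ℂ) := by
      conv_lhs => rw [← Complex.norm_mul_exp_arg_mul_I z]
      rw [mul_left_comm, ← Complex.exp_add]
      simp [θ]
    rw [← hz, h2] at h1
    have h3 := Complex.hasSum_re h1
    rw [Complex.ofReal_re] at h3
    refine h3.congr_fun fun k => ?_
    rw [mul_left_comm, ← Complex.exp_add, ← add_mul, ← Complex.ofReal_add, Complex.re_ofReal_mul,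
      Complex.exp_ofReal_mul_I_re]
    congr 2
    ring
  have hdiff : HasSum (fun k : ℤ => μ k * (1 - Real.cos (k * t - θ))) (1 - ‖z‖) := by
    simpa only [mul_sub, mul_one] using hμ.2.sub hcos
  have hnn : ∀ k : ℤ, 0 ≤ 1 - Real.cos (k * t - θ) := fun k => by
    linarith [Real.cos_le_one (k * t - θ)]
  have h1 : ∑ k ∈ S, μ k * (1 - Real.cos (k * t - θ)) ≤ 1 - ‖z‖ :=
    sum_le_hasSum S (fun k _ => mul_nonneg (hμ.1 k) (hnn k)) hdiff
  have h2 : δ * ∑ k ∈ S, (1 - Real.cos (k * t - θ)) ≤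
      ∑ k ∈ S, μ k * (1 - Real.cos (k * t - θ)) := by
    rw [Finset.mul_sum]
    exact Finset.sum_le_sum fun k hk =>
      mul_le_mul_of_nonneg_right (Finset.mem_filter.1 hk).2 (hnn k)
  have h3 := hcA S (Finset.filter_subset _ _) (exists_not_dvd_of_lt_sum hμ hcoset hSsum) t θ ht
  have h4 := mul_le_mul_of_nonneg_left h3 hδ.le
  have h5 := Real.add_one_le_exp (-(δ * c) * t ^ 2)
  linarith

end Aperiodic

section Fourier

/-- The `p`-th moment of `μ` twisted by the character `k ↦ e^{ikt}`. -/
noncomputable def expMoment (μ : ℤ → ℝ) (p : ℕ) (t : ℝ) : ℂ :=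
  ∑' k : ℤ, (k : ℂ) ^ p * Complex.exp ((k * t : ℝ) * Complex.I) * μ k

/-- Nonnegative weights on `ℤ` with finite moments up to order two. -/
structure HasSecondMoment (μ : ℤ → ℝ) : Prop where
  nonneg : ∀ k, 0 ≤ μ k
  summable : ∀ q ≤ 2, Summable fun k : ℤ => |(k : ℝ)| ^ q * μ k

theorem norm_expMoment_term {μ : ℤ → ℝ} (hμ : ∀ k, 0 ≤ μ k) (p : ℕ) (t : ℝ) (k : ℤ) :
    ‖(k : ℂ) ^ p * Complex.exp ((k * t : ℝ) * Complex.I) * μ k‖ = |(k : ℝ)| ^ p * μ k := by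
  rw [norm_mul, norm_mul, norm_pow, Complex.norm_exp_ofReal_mul_I, mul_one, Complex.norm_real,
    Real.norm_of_nonneg (hμ k), Complex.norm_intCast]

theorem HasSecondMoment.summable_norm {μ : ℤ → ℝ} (hμ : HasSecondMoment μ) {p : ℕ} (hp : p ≤ 2)
    (t : ℝ) :
    Summable fun k : ℤ => ‖(k : ℂ) ^ p * Complex.exp ((k * t : ℝ) * Complex.I) * μ k‖ := by
  simpa only [norm_expMoment_term hμ.nonneg] using hμ.summable p hp

theorem HasSecondMoment.hasSum {μ : ℤ → ℝ} (hμ : HasSecondMoment μ) {p : ℕ} (hp : p ≤ 2)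
    (t : ℝ) : HasSum (fun k : ℤ => (k : ℂ) ^ p * Complex.exp ((k * t : ℝ) * Complex.I) * μ k)
      (expMoment μ p t) :=
  (hμ.summable_norm hp t).of_norm.hasSum

theorem HasSecondMoment.norm_expMoment_le {μ : ℤ → ℝ} (hμ : HasSecondMoment μ) {p : ℕ}
    (hp : p ≤ 2) (t : ℝ) : ‖expMoment μ p t‖ ≤ ∑' k : ℤ, |(k : ℝ)| ^ p * μ k :=
  tsum_of_norm_bounded (hμ.summable p hp).hasSum fun k =>
    (norm_expMoment_term hμ.nonneg p t k).le

theorem hasSum_mul_conv {μ ν : ℤ → ℝ} {φ : ℤ → ℂ} {S : ℂ}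
    (h : HasSum (fun x : ℤ × ℤ => φ (x.1 + x.2) * ((μ x.1 : ℂ) * ν x.2)) S) :
    HasSum (fun k => φ k * (conv μ ν k : ℂ)) S := by
  let e : ℤ × ℤ ≃ ℤ × ℤ :=
    { toFun := fun x => (x.1 - x.2, x.2)
      invFun := fun x => (x.1 + x.2, x.2)
      left_inv := fun x => by simp
      right_inv := fun x => by simp }
  have h1 := e.hasSum_iff.2 h
  have h2 : ∀ k, HasSum (fun j => ((fun x : ℤ × ℤ => φ (x.1 + x.2) * ((μ x.1 : ℂ) * ν x.2)) ∘ e)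
      (k, j)) (φ k * (conv μ ν k : ℂ)) := by
    intro k
    have h3 := (h1.summable.prod_factor k).hasSum
    have h4 : ∑' j, ((fun x : ℤ × ℤ => φ (x.1 + x.2) * ((μ x.1 : ℂ) * ν x.2)) ∘ e) (k, j) =
        φ k * (conv μ ν k : ℂ) := by
      rw [conv, Complex.ofReal_tsum, ← tsum_mul_left]
      refine tsum_congr fun j => ?_
      simp [e]
    rwa [h4] at h3
  exact h1.prod_fiberwise h2

theorem hasSum_mul_of_summable_norm {f g : ℤ → ℂ} {a b : ℂ} (hf : Summable fun k => ‖f k‖)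
    (ha : HasSum f a) (hg : Summable fun k => ‖g k‖) (hb : HasSum g b) :
    HasSum (fun x : ℤ × ℤ => f x.1 * g x.2) (a * b) :=
  ha.mul hb (summable_mul_of_summable_norm hf hg)

theorem hasSum_expMoment_conv {μ ν : ℤ → ℝ} (hμ : HasSecondMoment μ) (hν : HasSecondMoment ν)
    {p : ℕ} (hp : p ≤ 2) (t : ℝ) :
    HasSum (fun k : ℤ => (k : ℂ) ^ p * Complex.exp ((k * t : ℝ) * Complex.I) * conv μ ν k)
      (∑ q ∈ Finset.range (p + 1),
        expMoment μ q t * expMoment ν (p - q) t * (p.choose q : ℂ)) := by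
  refine hasSum_mul_conv ?_
  have h : ∀ q ∈ Finset.range (p + 1), HasSum (fun x : ℤ × ℤ =>
      ((x.1 : ℂ) ^ q * Complex.exp ((x.1 * t : ℝ) * Complex.I) * μ x.1) *
      ((x.2 : ℂ) ^ (p - q) * Complex.exp ((x.2 * t : ℝ) * Complex.I) * ν x.2) *
        (p.choose q : ℂ))
      (expMoment μ q t * expMoment ν (p - q) t * (p.choose q : ℂ)) := by
    intro q hq
    have hq2 : q ≤ 2 := by have := Finset.mem_range.1 hq; omega
    have hq3 : p - q ≤ 2 := by omega
    exact (hasSum_mul_of_summable_norm (hμ.summable_norm hq2 t) (hμ.hasSum hq2 t)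
      (hν.summable_norm hq3 t) (hν.hasSum hq3 t)).mul_right _
  refine (hasSum_sum h).congr_fun fun x => ?_
  have he : Complex.exp (((x.1 + x.2 : ℤ) * t : ℝ) * Complex.I) =
      Complex.exp ((x.1 * t : ℝ) * Complex.I) * Complex.exp ((x.2 * t : ℝ) * Complex.I) := by
    rw [← Complex.exp_add]
    congr 1
    push_cast
    ring
  rw [he, Int.cast_add, add_pow, Finset.sum_mul, Finset.sum_mul]
  refine Finset.sum_congr rfl fun q _ => ?_
  ring

theorem HasSecondMoment.conv {μ ν : ℤ → ℝ} (hμ : HasSecondMoment μ) (hν : HasSecondMoment ν) :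
    HasSecondMoment (conv μ ν) := by
  have h0 : ∀ k, 0 ≤ _root_.conv μ ν k := fun k =>
    tsum_nonneg fun j => mul_nonneg (hμ.nonneg _) (hν.nonneg _)
  refine ⟨h0, fun q hq => ?_⟩
  simpa only [norm_expMoment_term h0] using (hasSum_expMoment_conv hμ hν hq 0).summable.norm

theorem expMoment_conv {μ ν : ℤ → ℝ} (hμ : HasSecondMoment μ) (hν : HasSecondMoment ν)
    {p : ℕ} (hp : p ≤ 2) (t : ℝ) : expMoment (conv μ ν) p t = ∑ q ∈ Finset.range (p + 1),
      expMoment μ q t * expMoment ν (p - q) t * (p.choose q : ℂ) :=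
  (hasSum_expMoment_conv hμ hν hp t).tsum_eq

theorem expMoment_conv_zero {μ ν : ℤ → ℝ} (hμ : HasSecondMoment μ) (hν : HasSecondMoment ν)
    (t : ℝ) : expMoment (conv μ ν) 0 t = expMoment μ 0 t * expMoment ν 0 t := by
  simp [expMoment_conv hμ hν (zero_le_two) t]

theorem expMoment_conv_one {μ ν : ℤ → ℝ} (hμ : HasSecondMoment μ) (hν : HasSecondMoment ν)
    (t : ℝ) : expMoment (conv μ ν) 1 t =
      expMoment μ 0 t * expMoment ν 1 t + expMoment μ 1 t * expMoment ν 0 t := by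
  simp [expMoment_conv hμ hν (one_le_two) t, Finset.sum_range_succ]

theorem expMoment_conv_two {μ ν : ℤ → ℝ} (hμ : HasSecondMoment μ) (hν : HasSecondMoment ν)
    (t : ℝ) : expMoment (conv μ ν) 2 t = expMoment μ 0 t * expMoment ν 2 t +
      2 * (expMoment μ 1 t * expMoment ν 1 t) + expMoment μ 2 t * expMoment ν 0 t := by
  simp [expMoment_conv hμ hν le_rfl t, Finset.sum_range_succ]
  ring

theorem norm_exp_sub_one_le_abs (x : ℝ) : ‖Complex.exp (x * Complex.I) - 1‖ ≤ |x| := by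
  refine le_of_sq_le_sq ?_ (abs_nonneg x)
  rw [norm_exp_sub_one_sq, sq_abs]
  linarith [Real.one_sub_sq_div_two_le_cos (x := x)]

/-- For a centred measure the first twisted moment is `O(t)`. -/
theorem HasSecondMoment.norm_expMoment_one_le {μ : ℤ → ℝ} (hμ : HasSecondMoment μ)
    (hE : expectation μ = 0) (t : ℝ) : ‖expMoment μ 1 t‖ ≤ m2 μ * |t| := by
  have h0 : HasSum (fun k : ℤ => (k : ℂ) * μ k) 0 := by
    have h1 : HasSum (fun k : ℤ => (k : ℝ) * μ k) 0 := by
      rw [← hE]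
      refine (Summable.of_norm ?_).hasSum
      simpa [abs_of_nonneg (hμ.nonneg _)] using hμ.summable 1 one_le_two
    simpa using Complex.hasSum_ofReal.2 h1
  have h := (hμ.hasSum one_le_two t).sub h0
  rw [sub_zero] at h
  rw [← h.tsum_eq]
  refine tsum_of_norm_bounded ((hμ.summable 2 le_rfl).hasSum.mul_right |t|) fun k => ?_
  rw [pow_one, show (k : ℂ) * Complex.exp ((k * t : ℝ) * Complex.I) * μ k - k * μ k =
    k * (Complex.exp ((k * t : ℝ) * Complex.I) - 1) * μ k by ring, norm_mul, norm_mul,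
    Complex.norm_real, Real.norm_of_nonneg (hμ.nonneg k), Complex.norm_intCast]
  have h1 := norm_exp_sub_one_le_abs (k * t)
  rw [abs_mul] at h1
  have h2 := mul_le_mul_of_nonneg_right
    (mul_le_mul_of_nonneg_left h1 (abs_nonneg (k : ℝ))) (hμ.nonneg k)
  calc _ ≤ _ := h2
    _ = _ := by ring

theorem integral_exp_int_mul (k : ℤ) :
    ∫ t in (-Real.pi)..Real.pi, Complex.exp ((k * t : ℝ) * Complex.I) =
      if k = 0 then (2 * Real.pi : ℂ) else 0 := by
  split_ifs with hk
  · simp [hk]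
    ring
  · have hk' : (k : ℂ) * Complex.I ≠ 0 := by simp [hk]
    have h1 : ∀ t : ℝ, Complex.exp ((k * t : ℝ) * Complex.I) =
        Complex.exp ((k : ℂ) * Complex.I * t) := fun t => by
      congr 1
      push_cast
      ring
    simp only [h1]
    rw [integral_exp_mul_complex hk']
    have h2 : Complex.exp ((k : ℂ) * Complex.I * (Real.pi : ℝ)) =
        Complex.exp ((k : ℂ) * Complex.I * (-Real.pi : ℝ)) := by
      rw [Complex.exp_eq_exp_iff_exists_int]
      refine ⟨k, ?_⟩
      push_cast
      ring
    rw [h2, sub_self, zero_div]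

/-- Fourier inversion for absolutely summable coefficients, with a Gaussian bound. -/
theorem norm_coeff_le_of_norm_charSum_le {f : ℤ → ℂ} (hf : Summable fun k => ‖f k‖) {K b : ℝ}
    (hb : 0 < b) (hK : 0 ≤ K)
    (h : ∀ t : ℝ, |t| ≤ Real.pi →
      ‖∑' k : ℤ, f k * Complex.exp ((k * t : ℝ) * Complex.I)‖ ≤ K * Real.exp (-b * t ^ 2))
    (k : ℤ) : ‖f k‖ ≤ K * Real.sqrt (Real.pi / b) := by
  have hpi := Real.pi_pos
  set F : ℝ → ℂ := fun t => ∑' j : ℤ, f j * Complex.exp ((j * t : ℝ) * Complex.I) with hF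
  have hFs : ∀ t, HasSum (fun j : ℤ => f j * Complex.exp ((j * t : ℝ) * Complex.I)) (F t) :=
    fun t => (Summable.of_norm (by
      simpa only [norm_mul, Complex.norm_exp_ofReal_mul_I, mul_one] using hf)).hasSum
  have h1 : HasSum (fun j : ℤ => ∫ t in (-Real.pi)..Real.pi,
        f j * Complex.exp (((j - k : ℤ) * t : ℝ) * Complex.I))
      (∫ t in (-Real.pi)..Real.pi, F t * Complex.exp ((-(k * t) : ℝ) * Complex.I)) := by
    refine intervalIntegral.hasSum_integral_of_dominated_convergence (fun j _ => ‖f j‖)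
      (fun j => Continuous.aestronglyMeasurable (by fun_prop))
      (fun j => Eventually.of_forall fun t _ => by
        rw [norm_mul, Complex.norm_exp_ofReal_mul_I, mul_one])
      (Eventually.of_forall fun t _ => hf) intervalIntegrable_const
      (Eventually.of_forall fun t _ => ?_)
    refine ((hFs t).mul_right _).congr_fun fun j => ?_
    rw [mul_assoc, ← Complex.exp_add]
    congr 2
    push_cast
    ring
  have h2 : ∫ t in (-Real.pi)..Real.pi, F t * Complex.exp ((-(k * t) : ℝ) * Complex.I) =
      f k * (2 * Real.pi) := by
    rw [← h1.tsum_eq, tsum_eq_single k]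
    · rw [intervalIntegral.integral_const_mul, integral_exp_int_mul, sub_self, if_pos rfl]
    · intro j hj
      rw [intervalIntegral.integral_const_mul, integral_exp_int_mul,
        if_neg (sub_ne_zero.2 hj), mul_zero]
  have hgint : Integrable fun t : ℝ => K * Real.exp (-b * t ^ 2) :=
    (integrable_exp_neg_mul_sq hb).const_mul K
  have h3 : ‖f k * (2 * Real.pi)‖ ≤ ∫ t in (-Real.pi)..Real.pi, K * Real.exp (-b * t ^ 2) := by
    rw [← h2]
    refine intervalIntegral.norm_integral_le_of_norm_le (by linarith)
      (Eventually.of_forall fun t ht => ?_) hgint.intervalIntegrable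
    rw [norm_mul, Complex.norm_exp_ofReal_mul_I, mul_one]
    exact h t (abs_le.2 ⟨ht.1.le, ht.2⟩)
  have h4 : ∫ t in (-Real.pi)..Real.pi, K * Real.exp (-b * t ^ 2) ≤
      K * Real.sqrt (Real.pi / b) := by
    rw [intervalIntegral.integral_of_le (by linarith), ← integral_gaussian,
      ← integral_const_mul]
    exact setIntegral_le_integral hgint (Eventually.of_forall fun t => by positivity)
  have h5 : ‖f k * (2 * Real.pi)‖ = ‖f k‖ * (2 * Real.pi) := by
    rw [norm_mul, norm_mul, Complex.norm_real, Real.norm_of_nonneg hpi.le]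
    simp
  have h6 : ‖f k‖ * 1 ≤ ‖f k‖ * (2 * Real.pi) :=
    mul_le_mul_of_nonneg_left (by linarith [Real.pi_gt_three]) (norm_nonneg _)
  linarith

end Fourier

/-- The maximum of `0` and the Birkhoff sums of `f` of length at most `N`. -/
noncomputable def birkhoffMax {X : Type*} (T : X → X) (f : X → ℝ) : ℕ → X → ℝ
  | 0 => fun _ => 0
  | N + 1 => fun x => max 0 (f x + birkhoffMax T f N (T x))

section Maximal

variable {X : Type*} {T : X → X} {f : X → ℝ}

theorem birkhoffMax_nonneg (N : ℕ) (x : X) : 0 ≤ birkhoffMax T f N x := by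
  cases N with
  | zero => exact le_rfl
  | succ N => exact le_max_left _ _

theorem birkhoffMax_le_succ (N : ℕ) (x : X) :
    birkhoffMax T f N x ≤ birkhoffMax T f (N + 1) x := by
  induction N generalizing x with
  | zero => exact birkhoffMax_nonneg 1 x
  | succ N ih => exact max_le_max le_rfl (add_le_add le_rfl (ih (T x)))

theorem birkhoffSum_le_birkhoffMax (N : ℕ) (x : X) :
    birkhoffSum T f N x ≤ birkhoffMax T f N x := by
  induction N generalizing x with
  | zero => simp [birkhoffMax]
  | succ N ih =>
    rw [birkhoffSum_succ']
    exact (add_le_add le_rfl (ih (T x))).trans (le_max_right _ _)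

variable [MeasurableSpace X] {m : Measure X}

theorem integrable_birkhoffMax (hT : MeasurePreserving T m m) (hf : Integrable f m) (N : ℕ) :
    Integrable (birkhoffMax T f N) m := by
  induction N with
  | zero => exact integrable_zero _ _ _
  | succ N ih =>
    exact (integrable_zero X ℝ m).sup (hf.add (hT.integrable_comp_of_integrable ih))

/-- **Hopf's maximal ergodic theorem**, in its finite form. -/
theorem integral_indicator_birkhoffMax_nonneg (hT : MeasurePreserving T m m)
    (hf : Integrable f m) (N : ℕ) :
    0 ≤ ∫ x, {x | 0 < birkhoffMax T f N x}.indicator f x ∂m := by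
  cases N with
  | zero => simp [birkhoffMax]
  | succ N =>
    have hF := integrable_birkhoffMax hT hf (N + 1)
    have hFT : Integrable (fun x => birkhoffMax T f (N + 1) (T x)) m :=
      hT.integrable_comp_of_integrable hF
    have hnull : NullMeasurableSet {x | 0 < birkhoffMax T f (N + 1) x} m :=
      nullMeasurableSet_lt aemeasurable_const hF.aemeasurable
    have hint : ∫ x, birkhoffMax T f (N + 1) (T x) ∂m = ∫ x, birkhoffMax T f (N + 1) x ∂m := by
      have := integral_map hT.measurable.aemeasurable
        (f := birkhoffMax T f (N + 1)) (by rw [hT.map_eq]; exact hF.aestronglyMeasurable)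
      rw [hT.map_eq] at this
      exact this.symm
    have h0 : ∫ x, (birkhoffMax T f (N + 1) x - birkhoffMax T f (N + 1) (T x)) ∂m = 0 := by
      rw [integral_sub hF hFT, hint, sub_self]
    refine h0.symm.le.trans ?_
    refine integral_mono (hF.sub hFT) (hf.indicator₀ hnull) fun x => ?_
    by_cases hx : 0 < birkhoffMax T f (N + 1) x
    · have h1 : birkhoffMax T f (N + 1) x = f x + birkhoffMax T f N (T x) := by
        rcases max_choice 0 (f x + birkhoffMax T f N (T x)) with h | h
        · exact absurd (h ▸ hx : 0 < (0 : ℝ)) (lt_irrefl _)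
        · exact h
      have h2 := birkhoffMax_le_succ (T := T) (f := f) N (T x)
      rw [Set.indicator_of_mem (show x ∈ {x | 0 < birkhoffMax T f (N + 1) x} from hx)]
      dsimp only
      linarith
    · rw [Set.indicator_of_notMem (show x ∉ {x | 0 < birkhoffMax T f (N + 1) x} from hx)]
      have h1 := birkhoffMax_nonneg (T := T) (f := f) (N + 1) (T x)
      dsimp only
      linarith

/-- The weak type `(1,1)` inequality for ergodic averages. -/
theorem measure_birkhoffSum_gt_le [IsProbabilityMeasure m] (hT : MeasurePreserving T m m)
    (hf : Integrable f m) (hf0 : 0 ≤ f) {lam : ℝ} (hlam : 0 < lam) :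
    m {x | ∃ N : ℕ, lam * N < birkhoffSum T f N x} ≤ ENNReal.ofReal ((∫ x, f x ∂m) / lam) := by
  set g : X → ℝ := fun x => f x - lam with hg
  have hgi : Integrable g m := hf.sub (integrable_const lam)
  have hsum : ∀ N x, birkhoffSum T g N x = birkhoffSum T f N x - lam * N := by
    intro N x
    simp [birkhoffSum, hg, Finset.sum_sub_distrib, mul_comm]
  have hsub : {x | ∃ N : ℕ, lam * N < birkhoffSum T f N x} ⊆
      ⋃ N, {x | 0 < birkhoffMax T g N x} := by
    rintro x ⟨N, hN⟩
    refine Set.mem_iUnion.2 ⟨N, lt_of_lt_of_le ?_ (birkhoffSum_le_birkhoffMax N x)⟩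
    rw [hsum]
    linarith
  refine (measure_mono hsub).trans ?_
  have hmono : Monotone fun N => {x | 0 < birkhoffMax T g N x} :=
    monotone_nat_of_le_succ fun N x hx => lt_of_lt_of_le hx (birkhoffMax_le_succ N x)
  rw [hmono.measure_iUnion]
  refine iSup_le fun N => ?_
  have hnull : NullMeasurableSet {x | 0 < birkhoffMax T g N x} m :=
    nullMeasurableSet_lt aemeasurable_const (integrable_birkhoffMax hT hgi N).aemeasurable
  have h1 := integral_indicator_birkhoffMax_nonneg hT hgi N
  rw [integral_indicator₀ hnull, integral_sub hf.integrableOn (integrable_const lam),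
    setIntegral_const, smul_eq_mul] at h1
  have h2 : ∫ x in {x | 0 < birkhoffMax T g N x}, f x ∂m ≤ ∫ x, f x ∂m :=
    setIntegral_le_integral hf (Eventually.of_forall hf0)
  rw [← ENNReal.ofReal_toReal (measure_ne_top m _)]
  refine ENNReal.ofReal_le_ofReal ?_
  rw [le_div_iff₀ hlam]
  change m.real _ * _ ≤ _
  linarith

end Maximal

/-- Summation by parts: averages with bounded partial sums have controlled weighted sums. -/
theorem sum_mul_le_of_antitone {w s : ℕ → ℝ} {lam : ℝ} (hw : Antitone w) (hw0 : ∀ n, 0 ≤ w n)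
    (hs : ∀ N : ℕ, ∑ j ∈ Finset.range N, s j ≤ lam * N) (N : ℕ) :
    ∑ j ∈ Finset.range N, w j * s j ≤ lam * ∑ j ∈ Finset.range N, w j := by
  have key : ∀ N : ℕ, ∑ j ∈ Finset.range (N + 1), w j * (s j - lam) ≤
      w N * ∑ j ∈ Finset.range (N + 1), (s j - lam) := by
    intro N
    induction N with
    | zero => simp
    | succ N ih =>
      rw [Finset.sum_range_succ, Finset.sum_range_succ _ (N + 1), mul_add]
      refine add_le_add (ih.trans ?_) le_rfl
      refine mul_le_mul_of_nonpos_right (hw N.le_succ) ?_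
      have := hs (N + 1)
      simp only [Finset.sum_sub_distrib, Finset.sum_const, Finset.card_range, nsmul_eq_mul]
      linarith
  cases N with
  | zero => simp
  | succ N =>
    have h2 : w N * ∑ j ∈ Finset.range (N + 1), (s j - lam) ≤ 0 := by
      refine mul_nonpos_of_nonneg_of_nonpos (hw0 N) ?_
      have := hs (N + 1)
      simp only [Finset.sum_sub_distrib, Finset.sum_const, Finset.card_range, nsmul_eq_mul]
      linarith
    have h1 := (key N).trans h2
    simp only [mul_sub, Finset.sum_sub_distrib, ← Finset.sum_mul] at h1
    linarith

theorem sum_div_add_sq_le {s : ℝ} (hs : 1 ≤ s) (N : ℕ) :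
    ∑ j ∈ Finset.range N, s / (s + j) ^ 2 ≤ 2 := by
  have key : ∑ j ∈ Finset.range N, s / (s + j) ^ 2 ≤ s / (s - 1 / 2) - s / (s + N - 1 / 2) := by
    induction N with
    | zero => simp
    | succ N ih =>
      rw [Finset.sum_range_succ]
      have hN : (0 : ℝ) ≤ N := N.cast_nonneg
      have : s / (s + N) ^ 2 ≤ s / (s + N - 1 / 2) - s / (s + (N + 1 : ℕ) - 1 / 2) := by
        push_cast
        have h1 : 0 < s + N - 1 / 2 := by linarith
        have h2 : 0 < s + (N + 1) - 1 / 2 := by linarith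
        rw [div_sub_div _ _ h1.ne' h2.ne', div_le_div_iff₀ (by positivity) (by positivity)]
        nlinarith
      linarith
  have hN : (0 : ℝ) ≤ N := N.cast_nonneg
  have h1 : 0 ≤ s / (s + N - 1 / 2) := div_nonneg (by linarith) (by linarith)
  have h2 : s / (s - 1 / 2) ≤ 2 := by rw [div_le_iff₀ (by linarith)]; linarith
  linarith

theorem summable_and_tsum_mul_le {v g : ℕ → ℝ} {C s lam : ℝ} (hs : 1 ≤ s) (hC : 0 ≤ C)
    (hv0 : ∀ j, 0 ≤ v j) (hv : ∀ j : ℕ, v j ≤ C * (s / (s + j) ^ 2)) (hg0 : ∀ j, 0 ≤ g j)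
    (hlam : 0 ≤ lam) (hg : ∀ N : ℕ, ∑ j ∈ Finset.range N, g j ≤ lam * N) :
    Summable (fun j => v j * g j) ∧ ∑' j, v j * g j ≤ 2 * C * lam := by
  have hw : Antitone fun j : ℕ => s / (s + j) ^ 2 := by
    intro i j hij
    have : (i : ℝ) ≤ j := by exact_mod_cast hij
    have hi : (0 : ℝ) ≤ i := i.cast_nonneg
    dsimp only
    gcongr
  have hb : ∀ N : ℕ, ∑ j ∈ Finset.range N, v j * g j ≤ 2 * C * lam := by
    intro N
    calc ∑ j ∈ Finset.range N, v j * g j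
        ≤ ∑ j ∈ Finset.range N, C * (s / (s + j) ^ 2 * g j) :=
          Finset.sum_le_sum fun j _ => by
            rw [← mul_assoc]; exact mul_le_mul_of_nonneg_right (hv j) (hg0 j)
      _ = C * ∑ j ∈ Finset.range N, s / (s + j) ^ 2 * g j := by rw [Finset.mul_sum]
      _ ≤ C * (lam * ∑ j ∈ Finset.range N, s / (s + j) ^ 2) :=
          mul_le_mul_of_nonneg_left
            (sum_mul_le_of_antitone hw (fun n => by positivity) hg N) hC
      _ ≤ C * (lam * 2) := by
          gcongr
          exact sum_div_add_sq_le hs N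
      _ = 2 * C * lam := by ring
  have hn : ∀ j, 0 ≤ v j * g j := fun j => mul_nonneg (hv0 j) (hg0 j)
  exact ⟨summable_of_sum_range_le hn hb, Real.tsum_le_of_sum_range_le hn hb⟩

/-- A sequence of probability measures on `ℤ` dominated by Poisson kernels and
asymptotically translation invariant. -/
structure IsPoissonKernelSeq (w : ℕ → ℤ → ℝ) (C : ℝ) : Prop where
  nonneg : ∀ n k, 0 ≤ w n k
  hasSum : ∀ n, HasSum (w n) 1
  const_nonneg : 0 ≤ C
  bound : ∀ n, ∃ s : ℝ, 1 ≤ s ∧ ∀ k : ℤ, w n k ≤ C * (s / (s + |(k : ℝ)|) ^ 2)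
  tendsto_diff : Tendsto (fun n => ∑' k, |w n (k - 1) - w n k|) atTop (nhds 0)

/-- The operator `f ↦ ∑ k, w k * f (τ ^ k x)`. -/
noncomputable def orbitSum {X : Type*} (τ : Equiv.Perm X) (w : ℤ → ℝ) (f : X → ℝ) (x : X) : ℝ :=
  ∑' k : ℤ, w k * f ((τ ^ k) x)

/-- Almost everywhere convergence of the orbit sums along a sequence of weights. -/
def AEConverges {X : Type*} [MeasurableSpace X] (m : Measure X) (τ : Equiv.Perm X)
    (w : ℕ → ℤ → ℝ) (f : X → ℝ) : Prop :=
  ∀ᵐ x ∂m, ∃ L : ℝ, Tendsto (fun n => orbitSum τ (w n) f x) atTop (nhds L)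

section Ergodic

variable {X : Type*} {τ : Equiv.Perm X} {w : ℕ → ℤ → ℝ} {C : ℝ}

theorem perm_zpow_neg_natCast_apply (j : ℕ) (x : X) : (τ ^ (-(j : ℤ))) x = τ.symm^[j] x := by
  rw [zpow_neg, zpow_natCast, ← inv_pow, Equiv.Perm.iterate_eq_pow]
  rfl

theorem perm_zpow_natCast_apply (j : ℕ) (x : X) : (τ ^ (j : ℤ)) x = τ^[j] x := by
  rw [zpow_natCast, Equiv.Perm.iterate_eq_pow]

theorem IsPoissonKernelSeq.summable_and_tsum_le (hw : IsPoissonKernelSeq w C) {g : X → ℝ}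
    (hg : 0 ≤ g) {lam : ℝ} (hlam : 0 ≤ lam) {x : X}
    (h1 : ∀ N : ℕ, birkhoffSum τ g N x ≤ lam * N)
    (h2 : ∀ N : ℕ, birkhoffSum τ.symm g N x ≤ lam * N) (n : ℕ) :
    Summable (fun k : ℤ => w n k * g ((τ ^ k) x)) ∧ orbitSum τ (w n) g x ≤ 4 * C * lam := by
  obtain ⟨s, hs, hb⟩ := hw.bound n
  have H1 := summable_and_tsum_mul_le (v := fun j : ℕ => w n j)
    (g := fun j : ℕ => g ((τ ^ (j : ℤ)) x)) hs hw.const_nonneg (fun j => hw.nonneg n _)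
    (fun j => by simpa using hb j) (fun j => hg _) hlam
    (fun N => by
      simpa only [perm_zpow_natCast_apply, birkhoffSum] using h1 N)
  have H2 := summable_and_tsum_mul_le (v := fun j : ℕ => w n (-(j : ℤ)))
    (g := fun j : ℕ => g ((τ ^ (-(j : ℤ))) x)) hs hw.const_nonneg (fun j => hw.nonneg n _)
    (fun j => by simpa using hb (-(j : ℤ))) (fun j => hg _) hlam
    (fun N => by
      simpa only [perm_zpow_neg_natCast_apply, birkhoffSum] using h2 N)
  have hsum : HasSum (fun k : ℤ => w n k * g ((τ ^ k) x)) _ :=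
    HasSum.of_nat_of_neg H1.1.hasSum H2.1.hasSum
  refine ⟨hsum.summable, ?_⟩
  rw [orbitSum, hsum.tsum_eq]
  have h0 : 0 ≤ w n 0 * g ((τ ^ (0 : ℤ)) x) := mul_nonneg (hw.nonneg n 0) (hg _)
  linarith [H1.2, H2.2]

variable [MeasurableSpace X] {m : Measure X}

/-- The maximal inequality for orbit sums. -/
theorem IsPoissonKernelSeq.exists_bad_set [IsProbabilityMeasure m]
    (hw : IsPoissonKernelSeq w C)
    (hτ : MeasurePreserving τ m m) (hτ' : MeasurePreserving τ.symm m m)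
    {f : X → ℝ} (hf : Integrable f m) {lam : ℝ} (hlam : 0 < lam) :
    ∃ B : Set X, m B ≤ ENNReal.ofReal (2 * (∫ x, |f x| ∂m) / lam) ∧
      ∀ x ∉ B, ∀ n, Summable (fun k : ℤ => w n k * f ((τ ^ k) x)) ∧
        |orbitSum τ (w n) f x| ≤ 4 * C * lam := by
  have hg : 0 ≤ fun x => |f x| := fun x => abs_nonneg _
  have B1 := measure_birkhoffSum_gt_le hτ hf.abs hg hlam
  have B2 := measure_birkhoffSum_gt_le hτ' hf.abs hg hlam
  refine ⟨_ ∪ _, (measure_union_le _ _).trans ((add_le_add B1 B2).trans ?_), ?_⟩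
  · have : 0 ≤ (∫ x, |f x| ∂m) / lam := div_nonneg (integral_nonneg hg) hlam.le
    rw [← ENNReal.ofReal_add this this]
    exact ENNReal.ofReal_le_ofReal (le_of_eq (by ring))
  · intro x hx n
    simp only [Set.mem_union, Set.mem_ofPred_eq, not_or, not_exists, not_lt] at hx
    obtain ⟨hs, hb⟩ := hw.summable_and_tsum_le hg hlam.le hx.1 hx.2 n
    have hs' : Summable fun k : ℤ => |w n k * f ((τ ^ k) x)| := by
      simpa only [abs_mul, abs_of_nonneg (hw.nonneg n _)] using hs
    refine ⟨hs'.of_abs, le_trans ?_ hb⟩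
    have := norm_tsum_le_tsum_norm (f := fun k : ℤ => w n k * f ((τ ^ k) x)) hs'
    simpa only [orbitSum, Real.norm_eq_abs, abs_mul, abs_of_nonneg (hw.nonneg n _)] using this

theorem IsPoissonKernelSeq.ae_summable [IsProbabilityMeasure m]
    (hw : IsPoissonKernelSeq w C)
    (hτ : MeasurePreserving τ m m) (hτ' : MeasurePreserving τ.symm m m)
    {f : X → ℝ} (hf : Integrable f m) :
    ∀ᵐ x ∂m, ∀ n, Summable (fun k : ℤ => w n k * f ((τ ^ k) x)) := by
  rw [ae_iff]
  refine le_antisymm (ENNReal.le_of_forall_pos_le_add fun ε hε _ => ?_) zero_le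
  have hI : 0 ≤ ∫ x, |f x| ∂m := integral_nonneg fun x => abs_nonneg _
  have hlam : 0 < (2 * (∫ x, |f x| ∂m) + 1) / (ε : ℝ) := by positivity
  obtain ⟨B, hB, hx⟩ := hw.exists_bad_set hτ hτ' hf hlam
  rw [zero_add]
  refine (measure_mono ?_).trans (hB.trans ?_)
  · intro x h
    by_contra hxB
    exact h fun n => (hx x hxB n).1
  · rw [ENNReal.ofReal_le_iff_le_toReal ENNReal.coe_ne_top, ENNReal.coe_toReal,
      div_le_iff₀ hlam, mul_div_cancel₀ _ (by positivity)]
    linarith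

/-- The Banach principle: a.e. convergence passes to `L¹` limits. -/
theorem IsPoissonKernelSeq.aeConverges_of_approx [IsProbabilityMeasure m]
    (hw : IsPoissonKernelSeq w C)
    (hτ : MeasurePreserving τ m m) (hτ' : MeasurePreserving τ.symm m m)
    {f : X → ℝ} (hf : Integrable f m)
    (h : ∀ ε > 0, ∃ g : X → ℝ, Integrable g m ∧ AEConverges m τ w g ∧
      ∫ x, |f x - g x| ∂m ≤ ε) : AEConverges m τ w f := by
  have key : ∀ δ > (0 : ℝ), ∀ᵐ x ∂m, ∃ N, ∀ n ≥ N,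
      |orbitSum τ (w n) f x - orbitSum τ (w N) f x| ≤ 3 * δ := by
    intro δ hδ
    have hC1 : 0 < 4 * (C + 1) := by linarith [hw.const_nonneg]
    set lam : ℝ := δ / (4 * (C + 1)) with hlamdef
    have hlam : 0 < lam := by positivity
    have hCl : 4 * C * lam ≤ δ := by
      have : 4 * (C + 1) * lam = δ := by rw [hlamdef, mul_div_cancel₀ _ hC1.ne']
      nlinarith
    rw [ae_iff]
    refine le_antisymm (ENNReal.le_of_forall_pos_le_add fun ε hε _ => ?_) zero_le
    have hε' : (0 : ℝ) < ε := hε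
    obtain ⟨g, hg, hgc, hfg⟩ := h (ε * lam / 2) (by positivity)
    obtain ⟨B, hB, hx⟩ := hw.exists_bad_set hτ hτ' (hf.sub hg) hlam
    have hsg := hw.ae_summable hτ hτ' hg
    rw [zero_add]
    have hBε : m B ≤ ε := by
      refine hB.trans ?_
      rw [ENNReal.ofReal_le_iff_le_toReal ENNReal.coe_ne_top, ENNReal.coe_toReal,
        div_le_iff₀ hlam]
      have : ∫ x, |(f - g) x| ∂m ≤ ε * lam / 2 := hfg
      linarith
    refine le_trans (measure_mono_ae ?_) hBε
    filter_upwards [hgc, hsg] with x hxg hxs hbad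
    by_contra hxB
    refine hbad ?_
    obtain ⟨L, hL⟩ := hxg
    obtain ⟨N, hN⟩ := Metric.cauchySeq_iff'.1 hL.cauchySeq δ hδ
    refine ⟨N, fun n hn => ?_⟩
    have hdec : ∀ n, orbitSum τ (w n) f x =
        orbitSum τ (w n) (f - g) x + orbitSum τ (w n) g x := by
      intro n
      rw [orbitSum, orbitSum, orbitSum, ← (hx x hxB n).1.tsum_add (hxs n)]
      refine tsum_congr fun k => ?_
      simp only [Pi.sub_apply]
      ring
    have h1 := abs_le.1 ((hx x hxB n).2.trans hCl)
    have h2 := abs_le.1 ((hx x hxB N).2.trans hCl)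
    have h3 := abs_lt.1 (hN n hn)
    rw [hdec, hdec N, abs_le]
    constructor <;> linarith
  have key' : ∀ᵐ x ∂m, ∀ j : ℕ, ∃ N, ∀ n ≥ N,
      |orbitSum τ (w n) f x - orbitSum τ (w N) f x| ≤ 3 * (1 / ((j : ℝ) + 1)) :=
    ae_all_iff.2 fun j => key _ (by positivity)
  filter_upwards [key'] with x hx
  refine cauchySeq_tendsto_of_complete (Metric.cauchySeq_iff'.2 fun ε hε => ?_)
  obtain ⟨j, hj⟩ := exists_nat_one_div_lt (show 0 < ε / 3 by positivity)
  obtain ⟨N, hN⟩ := hx j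
  refine ⟨N, fun n hn => ?_⟩
  rw [Real.dist_eq]
  exact (hN n hn).trans_lt (by linarith)

theorem IsPoissonKernelSeq.aeConverges_add [IsProbabilityMeasure m]
    (hw : IsPoissonKernelSeq w C)
    (hτ : MeasurePreserving τ m m) (hτ' : MeasurePreserving τ.symm m m)
    {f g : X → ℝ} (hf : Integrable f m) (hg : Integrable g m)
    (hfc : AEConverges m τ w f) (hgc : AEConverges m τ w g) :
    AEConverges m τ w (f + g) := by
  filter_upwards [hw.ae_summable hτ hτ' hf, hw.ae_summable hτ hτ' hg, hfc, hgc]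
    with x h1 h2 ⟨L, hL⟩ ⟨M, hM⟩
  refine ⟨L + M, (hL.add hM).congr fun n => ?_⟩
  rw [orbitSum, orbitSum, orbitSum, ← (h1 n).tsum_add (h2 n)]
  exact tsum_congr fun k => (mul_add _ _ _).symm

theorem IsPoissonKernelSeq.aeConverges_invariant (hw : IsPoissonKernelSeq w C)
    (hτ : MeasurePreserving τ m m) (hτ' : MeasurePreserving τ.symm m m)
    {f : X → ℝ} (hf : f ∘ τ =ᵐ[m] f) : AEConverges m τ w f := by
  have h1 : ∀ᵐ x ∂m, ∀ j : ℕ, f (τ^[j + 1] x) = f (τ^[j] x) :=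
    ae_all_iff.2 fun j => by
      filter_upwards [(hτ.iterate j).quasiMeasurePreserving.ae hf] with x hx
      rw [Function.iterate_succ_apply']
      exact hx
  have h2 : ∀ᵐ x ∂m, ∀ j : ℕ, f (τ.symm^[j + 1] x) = f (τ.symm^[j] x) :=
    ae_all_iff.2 fun j => by
      filter_upwards [(hτ'.iterate (j + 1)).quasiMeasurePreserving.ae hf] with x hx
      rw [← hx, Function.iterate_succ_apply', Function.comp_apply, Equiv.apply_symm_apply]
  filter_upwards [h1, h2] with x h1 h2
  have h1' : ∀ j : ℕ, f (τ^[j] x) = f x := fun j => by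
    induction j with
    | zero => rfl
    | succ j ih => rw [h1, ih]
  have h2' : ∀ j : ℕ, f (τ.symm^[j] x) = f x := fun j => by
    induction j with
    | zero => rfl
    | succ j ih => rw [h2, ih]
  have h : ∀ k : ℤ, f ((τ ^ k) x) = f x := fun k => by
    rcases Int.eq_nat_or_neg k with ⟨j, rfl | rfl⟩
    · rw [perm_zpow_natCast_apply, h1']
    · rw [perm_zpow_neg_natCast_apply, h2']
  refine ⟨f x, ?_⟩
  simp only [orbitSum, h, tsum_mul_right, (hw.hasSum _).tsum_eq, one_mul]
  exact tendsto_const_nhds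

theorem IsPoissonKernelSeq.aeConverges_coboundary_of_bounded (hw : IsPoissonKernelSeq w C)
    {h : X → ℝ} {b : ℝ} (hb : ∀ x, |h x| ≤ b) : AEConverges m τ w (h ∘ τ - h) := by
  refine Eventually.of_forall fun x => ⟨0, ?_⟩
  have hsw : ∀ n, Summable (w n) := fun n => (hw.hasSum n).summable
  have hsw' : ∀ n, Summable fun k => w n (k - 1) := fun n =>
    (Equiv.subRight (1 : ℤ)).summable_iff.2 (hsw n)
  have hbd : ∀ (v : ℤ → ℝ), Summable v → Summable fun k : ℤ => v k * h ((τ ^ k) x) := fun v hv =>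
    Summable.of_norm_bounded (hv.abs.mul_right b) fun k => by
      rw [norm_mul]
      exact mul_le_mul_of_nonneg_left (hb _) (abs_nonneg _)
  have hb0 : 0 ≤ b := (abs_nonneg _).trans (hb x)
  have heq : ∀ n, orbitSum τ (w n) (h ∘ τ - h) x =
      ∑' k : ℤ, (w n (k - 1) - w n k) * h ((τ ^ k) x) := by
    intro n
    have e1 : ∑' k : ℤ, w n (k - 1) * h ((τ ^ k) x) = ∑' k : ℤ, w n k * h ((τ ^ (k + 1)) x) := by
      rw [← (Equiv.addRight (1 : ℤ)).tsum_eq]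
      simp
    have hs1 : Summable fun k : ℤ => w n k * h ((τ ^ (k + 1)) x) := by
      have := (Equiv.addRight (1 : ℤ)).summable_iff.2 (hbd _ (hsw' n))
      simpa [Function.comp_def] using this
    simp only [sub_mul]
    rw [(hbd _ (hsw' n)).tsum_sub (hbd _ (hsw n)), e1, ← hs1.tsum_sub (hbd _ (hsw n)), orbitSum]
    refine tsum_congr fun k => ?_
    rw [← mul_sub, Pi.sub_apply, Function.comp_apply, add_comm k 1, zpow_one_add,
      Equiv.Perm.mul_apply]
  refine squeeze_zero_norm (fun n => ?_) (by simpa using hw.tendsto_diff.mul_const b)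
  have hd : Summable fun k => |w n (k - 1) - w n k| := ((hsw' n).sub (hsw n)).abs
  rw [heq, ← tsum_mul_right]
  refine tsum_of_norm_bounded (hd.mul_right b).hasSum fun k => ?_
  rw [norm_mul]
  exact mul_le_mul_of_nonneg_left (hb _) (abs_nonneg _)

theorem exists_bounded_integral_abs_sub_le {f : X → ℝ} (hf : Integrable f m) {ε : ℝ}
    (hε : 0 < ε) : ∃ (g : X → ℝ) (b : ℝ), (∀ x, |g x| ≤ b) ∧ Integrable g m ∧
      ∫ x, |f x - g x| ∂m ≤ ε := by
  obtain ⟨g, hg, hgL⟩ := (memLp_one_iff_integrable.2 hf).exists_simpleFunc_eLpNorm_sub_lt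
    ENNReal.one_ne_top (ε := ENNReal.ofReal ε) (by simpa using hε)
  have hgi : Integrable g m := memLp_one_iff_integrable.1 hgL
  obtain ⟨b, hb⟩ := g.exists_forall_norm_le
  refine ⟨g, b, hb, hgi, ?_⟩
  rw [eLpNorm_one_eq_lintegral_enorm] at hg
  have h := integral_norm_eq_lintegral_enorm (hf.sub hgi).aestronglyMeasurable
  simp only [Real.norm_eq_abs, Pi.sub_apply] at h
  rw [h]
  exact ENNReal.toReal_le_of_le_ofReal hε.le hg.le

theorem IsPoissonKernelSeq.aeConverges_coboundary [IsProbabilityMeasure m]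
    (hw : IsPoissonKernelSeq w C)
    (hτ : MeasurePreserving τ m m) (hτ' : MeasurePreserving τ.symm m m)
    {h : X → ℝ} (hh : Integrable h m) : AEConverges m τ w (h ∘ τ - h) := by
  have hcomp : ∀ {u : X → ℝ}, Integrable u m → Integrable (u ∘ τ) m := fun hu =>
    hτ.integrable_comp_of_integrable hu
  refine hw.aeConverges_of_approx hτ hτ' ((hcomp hh).sub hh) fun ε hε => ?_
  obtain ⟨g, b, hb, hgi, hn⟩ := exists_bounded_integral_abs_sub_le hh (half_pos hε)
  refine ⟨g ∘ τ - g, (hcomp hgi).sub hgi, hw.aeConverges_coboundary_of_bounded hb, ?_⟩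
  have hd : Integrable (h - g) m := hh.sub hgi
  have hn' : ∫ x, |(h - g) (τ x)| ∂m = ∫ x, |(h - g) x| ∂m := by
    have := integral_map hτ.measurable.aemeasurable
      (f := fun x => |(h - g) x|) (by rw [hτ.map_eq]; exact hd.abs.aestronglyMeasurable)
    rw [hτ.map_eq] at this
    exact this.symm
  calc ∫ x, |(h ∘ τ - h) x - (g ∘ τ - g) x| ∂m
      ≤ ∫ x, (|(h - g) (τ x)| + |(h - g) x|) ∂m := by
        refine integral_mono (((hcomp hh).sub hh).sub ((hcomp hgi).sub hgi)).abs
          ((hcomp hd).abs.add hd.abs) fun x => ?_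
        simp only [Pi.sub_apply, Function.comp_apply]
        rw [show h (τ x) - h x - (g (τ x) - g x) = (h (τ x) - g (τ x)) - (h x - g x) by ring]
        exact abs_sub _ _
    _ = ∫ x, |(h - g) (τ x)| ∂m + ∫ x, |(h - g) x| ∂m :=
        integral_add (hcomp hd).abs hd.abs
    _ ≤ ε := by
        rw [hn']
        have hn : ∫ x, |(h - g) x| ∂m ≤ ε / 2 := hn
        linarith

/-- Fixed vectors and coboundaries span a dense subspace of `L²`. -/
theorem exists_invariant_add_coboundary [IsProbabilityMeasure m] (hτ : MeasurePreserving τ m m)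
    {f : X → ℝ} (hf : MemLp f 2 m) {ε : ℝ} (hε : 0 < ε) :
    ∃ p h : X → ℝ, Integrable p m ∧ Integrable h m ∧ p ∘ τ =ᵐ[m] p ∧
      ∫ x, |f x - (p + (h ∘ τ - h)) x| ∂m ≤ ε := by
  let U : Lp ℝ 2 m →L[ℝ] Lp ℝ 2 m :=
    (Lp.compMeasurePreservingₗᵢ ℝ (τ : X → X) hτ).toContinuousLinearMap
  have hU1 : ‖U‖ ≤ 1 := LinearIsometry.norm_toContinuousLinearMap_le _
  have hU : ∀ v : Lp ℝ 2 m, U v =ᵐ[m] v ∘ τ := fun v => Lp.coeFn_compMeasurePreserving v hτ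
  let F : Lp ℝ 2 m := hf.toLp f
  let P : Lp ℝ 2 m := (U.eqLocus (1 : Lp ℝ 2 m →L[ℝ] Lp ℝ 2 m)).orthogonalProjectionOnto F
  have hP : U P = P :=
    ((U.eqLocus (1 : Lp ℝ 2 m →L[ℝ] Lp ℝ 2 m)).orthogonalProjectionOnto F).2
  have hcl : F - P ∈ closure (Set.range fun v => U v - v) := by
    let R : Submodule ℝ (Lp ℝ 2 m) := (U - 1).range
    have hR : Rᗮ ≤ U.eqLocus (1 : Lp ℝ 2 m →L[ℝ] Lp ℝ 2 m) := fun x hx => by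
      refine eq_of_norm_le_re_inner_eq_norm_sq (𝕜 := ℝ) ?_ ?_
      · simpa using U.le_of_opNorm_le hU1 x
      · have : ∀ y, inner ℝ (U y) x = inner ℝ y x := fun y => by
          have h := (Submodule.mem_orthogonal _ _).1 hx ((U - 1) y) ⟨y, rfl⟩
          rwa [sub_apply, one_apply_eq_self, inner_sub_left,
            sub_eq_zero] at h
        simp [this]
    have h1 : F - P ∈ Rᗮᗮ :=
      Submodule.orthogonal_le hR (Submodule.sub_starProjection_mem_orthogonal F)
    rw [Submodule.orthogonal_orthogonal_eq_closure, ← SetLike.mem_coe,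
      Submodule.topologicalClosure_coe] at h1
    refine closure_mono ?_ h1
    rintro _ ⟨v, rfl⟩
    exact ⟨v, rfl⟩
  obtain ⟨_, ⟨H, rfl⟩, hH⟩ := Metric.mem_closure_iff.1 hcl ε hε
  have hint : ∀ v : Lp ℝ 2 m, Integrable v m := fun v => (Lp.memLp v).integrable (by norm_num)
  refine ⟨P, H, hint P, hint H, ?_, ?_⟩
  · have := hU P
    rw [hP] at this
    exact this.symm
  · set v : Lp ℝ 2 m := F - P - (U H - H) with hv
    have hvn : ‖v‖ ≤ ε := by rw [← dist_eq_norm]; exact hH.le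
    have hae : ∀ᵐ x ∂m, |f x - (P + (H ∘ τ - H) : X → ℝ) x| = ‖v x‖ := by
      filter_upwards [hf.coeFn_toLp, Lp.coeFn_sub F P, Lp.coeFn_sub (U H) H,
        Lp.coeFn_sub (F - P) (U H - H), hU H] with x h1 h2 h3 h4 h5
      rw [h4, Pi.sub_apply, h2, h3, Pi.sub_apply, Pi.sub_apply, h5, h1, Real.norm_eq_abs]
      congr 1
      simp only [Pi.add_apply, Pi.sub_apply, Function.comp_apply]
      ring
    rw [integral_congr_ae hae, integral_norm_eq_lintegral_enorm (hint v).aestronglyMeasurable,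
      ← eLpNorm_one_eq_lintegral_enorm]
    refine (ENNReal.toReal_mono (Lp.eLpNorm_ne_top v) ?_).trans hvn
    exact eLpNorm_le_eLpNorm_of_exponent_le (by norm_num) (Lp.aestronglyMeasurable v)

/-- Orbit sums along a Poisson-dominated, asymptotically invariant sequence of weights converge
almost everywhere for integrable functions. -/
theorem IsPoissonKernelSeq.aeConverges [IsProbabilityMeasure m]
    (hw : IsPoissonKernelSeq w C)
    (hτ : MeasurePreserving τ m m) (hτ' : MeasurePreserving τ.symm m m)
    {f : X → ℝ} (hf : Integrable f m) : AEConverges m τ w f := by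
  refine hw.aeConverges_of_approx hτ hτ' hf fun ε hε => ?_
  obtain ⟨g, b, hb, hgi, hn⟩ := exists_bounded_integral_abs_sub_le hf hε
  have hg2 : MemLp g 2 m := MemLp.of_bound hgi.aestronglyMeasurable b (Eventually.of_forall hb)
  refine ⟨g, hgi, hw.aeConverges_of_approx hτ hτ' hgi fun ε hε => ?_, hn⟩
  obtain ⟨p, h, hp, hh, hinv, happ⟩ := exists_invariant_add_coboundary hτ hg2 hε
  have hh' : Integrable (h ∘ τ - h) m := (hτ.integrable_comp_of_integrable hh).sub hh
  exact ⟨_, hp.add hh', hw.aeConverges_add hτ hτ' hp hh'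
    (hw.aeConverges_invariant hτ hτ' hinv) (hw.aeConverges_coboundary hτ hτ' hh), happ⟩

end Ergodic

section Convolutions

theorem IsProbMeasure.hasSecondMoment {μ : ℤ → ℝ} (hμ : IsProbMeasure μ)
    (h1 : Summable fun k : ℤ => |(k : ℝ)| * μ k)
    (h2 : Summable fun k : ℤ => |(k : ℝ)| ^ 2 * μ k) : HasSecondMoment μ := by
  refine ⟨hμ.1, fun q hq => ?_⟩
  interval_cases q
  · simpa using hμ.2.summable
  · simpa using h1
  · exact h2

theorem HasSecondMoment.muN {ν : ℕ → ℤ → ℝ} (hν : ∀ n, HasSecondMoment (ν n)) :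
    ∀ n, HasSecondMoment (muN ν n)
  | 0 => hν 0
  | n + 1 => (HasSecondMoment.muN hν n).conv (hν (n + 1))

theorem IsProbMeasure.conv {μ ν : ℤ → ℝ} (hμ : IsProbMeasure μ) (hν : IsProbMeasure ν)
    (hμ2 : HasSecondMoment μ) (hν2 : HasSecondMoment ν) : IsProbMeasure (conv μ ν) := by
  refine ⟨(hμ2.conv hν2).nonneg, ?_⟩
  have hone : ∀ {η : ℤ → ℝ}, IsProbMeasure η → expMoment η 0 0 = 1 := fun h => by
    simpa [expMoment] using (Complex.hasSum_ofReal.2 h.2).tsum_eq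
  have h := hasSum_expMoment_conv hμ2 hν2 (zero_le_two) 0
  rw [← Complex.hasSum_ofReal]
  simpa [hone hμ, hone hν] using h

theorem IsProbMeasure.muN {ν : ℕ → ℤ → ℝ} (hp : ∀ n, IsProbMeasure (ν n))
    (hν : ∀ n, HasSecondMoment (ν n)) : ∀ n, IsProbMeasure (muN ν n)
  | 0 => hp 0
  | n + 1 => (IsProbMeasure.muN hp hν n).conv (hp (n + 1)) (HasSecondMoment.muN hν n) (hν (n + 1))

theorem m2_nonneg {μ : ℤ → ℝ} (hμ : HasSecondMoment μ) : 0 ≤ m2 μ :=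
  tsum_nonneg fun k => mul_nonneg (by positivity) (hμ.nonneg k)

theorem norm_expMoment_muN_le {ν : ℕ → ℤ → ℝ} (hν : ∀ n, HasSecondMoment (ν n))
    (hE : ∀ n, expectation (ν n) = 0) {t r : ℝ} (hr : 0 ≤ r) (hr1 : r ≤ 1)
    (h0 : ∀ n, ‖expMoment (ν n) 0 t‖ ≤ r) (n : ℕ) :
    ‖expMoment (muN ν n) 0 t‖ ≤ r ^ (n + 1) ∧
    ‖expMoment (muN ν n) 1 t‖ * r ≤
      (∑ i ∈ Finset.range (n + 1), m2 (ν i)) * |t| * r ^ (n + 1) ∧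
    ‖expMoment (muN ν n) 2 t‖ * r ^ 2 ≤ (∑ i ∈ Finset.range (n + 1), m2 (ν i) +
      (∑ i ∈ Finset.range (n + 1), m2 (ν i)) ^ 2 * t ^ 2) * r ^ (n + 1) := by
  have he1 : ∀ n, ‖expMoment (ν n) 1 t‖ ≤ m2 (ν n) * |t| := fun n =>
    (hν n).norm_expMoment_one_le (hE n) t
  have he2 : ∀ n, ‖expMoment (ν n) 2 t‖ ≤ m2 (ν n) := fun n => (hν n).norm_expMoment_le le_rfl t
  have hm : ∀ n, 0 ≤ m2 (ν n) := fun n => m2_nonneg (hν n)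
  have hrr : r ^ 2 ≤ r := by nlinarith
  induction n with
  | zero =>
    simp only [muN, zero_add, Finset.range_one, Finset.sum_singleton, pow_one]
    refine ⟨h0 0, mul_le_mul_of_nonneg_right (he1 0) hr, ?_⟩
    have := mul_nonneg (sq_nonneg (m2 (ν 0))) (sq_nonneg t)
    exact mul_le_mul ((he2 0).trans (by linarith)) hrr (sq_nonneg r) (by linarith [hm 0])
  | succ n ih =>
    obtain ⟨i0, i1, i2⟩ := ih
    have hM := HasSecondMoment.muN hν n
    have hm' := hm (n + 1)
    have hΦ : 0 ≤ ∑ i ∈ Finset.range (n + 1), m2 (ν i) := Finset.sum_nonneg fun i _ => hm i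
    rw [Finset.sum_range_succ _ (n + 1)]
    generalize (∑ i ∈ Finset.range (n + 1), m2 (ν i)) = Φ at *
    have hP : 0 ≤ r ^ (n + 1) := by positivity
    rw [pow_succ r (n + 1)]
    generalize r ^ (n + 1) = P at *
    simp only [muN, expMoment_conv_zero hM (hν _), expMoment_conv_one hM (hν _),
      expMoment_conv_two hM (hν _)]
    have a0 := h0 (n + 1)
    have a1 := he1 (n + 1)
    have a2 := he2 (n + 1)
    generalize m2 (ν (n + 1)) = m at *
    generalize expMoment (ν (n + 1)) 0 t = e0 at *
    generalize expMoment (ν (n + 1)) 1 t = e1 at *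
    generalize expMoment (ν (n + 1)) 2 t = e2 at *
    generalize expMoment (muN ν n) 0 t = E0 at *
    generalize expMoment (muN ν n) 1 t = E1 at *
    generalize expMoment (muN ν n) 2 t = E2 at *
    have ht := abs_nonneg t
    refine ⟨?_, ?_, ?_⟩
    · rw [norm_mul]
      exact mul_le_mul i0 a0 (norm_nonneg _) hP
    · have b1 : ‖E0‖ * ‖e1‖ ≤ P * (m * |t|) := mul_le_mul i0 a1 (norm_nonneg _) hP
      have b2 : ‖E1‖ * r * ‖e0‖ ≤ Φ * |t| * P * r :=
        mul_le_mul i1 a0 (norm_nonneg _) (by positivity)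
      have b3 := mul_le_mul_of_nonneg_right b1 hr
      have b4 := mul_le_mul_of_nonneg_right
        ((norm_add_le (E0 * e1) (E1 * e0)).trans_eq (by rw [norm_mul, norm_mul])) hr
      linarith
    · have b1 : ‖E0‖ * ‖e2‖ ≤ P * m := mul_le_mul i0 a2 (norm_nonneg _) hP
      have b2 : ‖E1‖ * r * ‖e1‖ ≤ Φ * |t| * P * (m * |t|) :=
        mul_le_mul i1 a1 (norm_nonneg _) (by positivity)
      have b3 : ‖E2‖ * r ^ 2 * ‖e0‖ ≤ (Φ + Φ ^ 2 * t ^ 2) * P * r :=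
        mul_le_mul i2 a0 (norm_nonneg _) (by positivity)
      have b4 : ‖E0 * e2 + 2 * (E1 * e1) + E2 * e0‖ ≤
          ‖E0‖ * ‖e2‖ + 2 * (‖E1‖ * ‖e1‖) + ‖E2‖ * ‖e0‖ := by
        refine (norm_add₃_le).trans_eq ?_
        simp only [norm_mul, Complex.norm_ofNat]
      have b5 := mul_le_mul_of_nonneg_right b4 (sq_nonneg r)
      have b6 := mul_le_mul b1 hrr (sq_nonneg r) (by positivity)
      have b7 := mul_le_mul_of_nonneg_right b2 hr
      have b8 : 0 ≤ m ^ 2 * t ^ 2 * (P * r) := by positivity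
      have htt := abs_mul_abs_self t
      have b9 : Φ * |t| * P * (m * |t|) * r = Φ * P * m * r * (t * t) := by
        rw [← htt]
        ring
      nlinarith

theorem m2_muN_le {ν : ℕ → ℤ → ℝ} (hp : ∀ n, IsProbMeasure (ν n))
    (hν : ∀ n, HasSecondMoment (ν n)) (hE : ∀ n, expectation (ν n) = 0) (n : ℕ) :
    m2 (muN ν n) ≤ ∑ i ∈ Finset.range (n + 1), m2 (ν i) := by
  have h0 : ∀ n, ‖expMoment (ν n) 0 0‖ ≤ 1 := fun n =>
    ((hν n).norm_expMoment_le zero_le_two 0).trans_eq (by simpa using (hp n).2.tsum_eq)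
  have h := (norm_expMoment_muN_le hν hE zero_le_one le_rfl h0 n).2.2
  have h1 : expMoment (muN ν n) 2 0 = (m2 (muN ν n) : ℂ) := by
    rw [m2, Complex.ofReal_tsum]
    exact tsum_congr fun k => by simp [sq_abs]
  rw [h1, Complex.norm_real, Real.norm_of_nonneg (m2_nonneg (HasSecondMoment.muN hν n))] at h
  simpa using h

/-- If `w` has small second moment and slowly varying values, then it is almost shift-invariant. -/
theorem tsum_abs_sub_le {w : ℤ → ℝ} (hw : HasSecondMoment w) {δ V : ℝ}
    (hδ : ∀ k, |w (k - 1) - w k| ≤ δ) (hV : m2 w ≤ V) {R : ℕ} (hR : 0 < R) :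
    ∑' k, |w (k - 1) - w k| ≤ (2 * R + 1) * δ + 2 * V / R ^ 2 := by
  have hR' : (0 : ℝ) < R := by exact_mod_cast hR
  have hδ0 : 0 ≤ δ := (abs_nonneg _).trans (hδ 0)
  have h1 : HasSum (fun k : ℤ => if k ∈ Finset.Icc (-(R : ℤ)) R then δ else 0)
      ((2 * R + 1) * δ) := by
    have h := hasSum_sum_of_ne_finset_zero (f := fun k : ℤ =>
      if k ∈ Finset.Icc (-(R : ℤ)) R then δ else 0) (s := Finset.Icc (-(R : ℤ)) R)
      (L := .unconditional ℤ) fun k hk => if_neg hk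
    rw [Finset.sum_congr rfl fun k hk => if_pos hk, Finset.sum_const, Int.card_Icc, nsmul_eq_mul,
      show ((R : ℤ) + 1 - -R).toNat = 2 * R + 1 by omega] at h
    exact_mod_cast h
  have h2 : HasSum (fun k : ℤ => |(k : ℝ)| ^ 2 * w k) (m2 w) := (hw.summable 2 le_rfl).hasSum
  have h3 : HasSum (fun k : ℤ => |((k - 1 : ℤ) : ℝ)| ^ 2 * w (k - 1)) (m2 w) :=
    (Equiv.subRight (1 : ℤ)).hasSum_iff.2 h2
  have h4 := h1.add ((h2.add h3).div_const ((R : ℝ) ^ 2))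
  have h5 : ∀ k, ‖|w (k - 1) - w k|‖ ≤ (if k ∈ Finset.Icc (-(R : ℤ)) R then δ else 0) +
      (|(k : ℝ)| ^ 2 * w k + |((k - 1 : ℤ) : ℝ)| ^ 2 * w (k - 1)) / (R : ℝ) ^ 2 := by
    intro k
    have hk := hw.nonneg k
    have hk' := hw.nonneg (k - 1)
    rw [Real.norm_eq_abs, abs_abs]
    split_ifs with hkR
    · exact (hδ k).trans (le_add_of_nonneg_right (by positivity))
    · have hbig : ∀ j : ℤ, (R : ℤ) ≤ |j| → w j ≤ |(j : ℝ)| ^ 2 * w j / (R : ℝ) ^ 2 := by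
        intro j hj
        have hj' : (R : ℝ) ≤ |(j : ℝ)| := by exact_mod_cast hj
        rw [le_div_iff₀ (by positivity), mul_comm]
        exact mul_le_mul_of_nonneg_right (by gcongr) (hw.nonneg j)
      have hkk : ¬(-(R : ℤ) ≤ k ∧ k ≤ R) := fun h => hkR (Finset.mem_Icc.2 h)
      have g1 := hbig k (by rw [le_abs]; omega)
      have g2 := hbig (k - 1) (by rw [le_abs]; omega)
      have g3 : |w (k - 1) - w k| ≤ w (k - 1) + w k := by
        rw [abs_le]
        constructor <;> linarith
      rw [zero_add, add_div]
      linarith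
  have h6 := tsum_of_norm_bounded h4 h5
  rw [Real.norm_of_nonneg (tsum_nonneg fun k => abs_nonneg _)] at h6
  have h7 : (m2 w + m2 w) / (R : ℝ) ^ 2 ≤ 2 * V / R ^ 2 := by
    gcongr
    linarith
  linarith

theorem tendsto_tsum_abs_sub {w : ℕ → ℤ → ℝ} (hw : ∀ n, HasSecondMoment (w n)) {κ K : ℝ}
    (hκ : 0 ≤ κ) (hK : 0 ≤ K) (hδ : ∀ (n : ℕ) k, |w n (k - 1) - w n k| ≤ κ / (n + 1))
    (hV : ∀ n : ℕ, m2 (w n) ≤ K * (n + 1)) :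
    Tendsto (fun n => ∑' k, |w n (k - 1) - w n k|) atTop (nhds 0) := by
  set u : ℕ → ℝ := fun n => √(√((n : ℝ) + 1)) with hu
  have hu1 : ∀ n, 1 ≤ u n := fun n => by
    simp only [hu, Real.one_le_sqrt]
    linarith [(Nat.cast_nonneg n : (0 : ℝ) ≤ n)]
  have hu4 : ∀ n : ℕ, (n : ℝ) + 1 = u n ^ 4 := fun n => by
    rw [show 4 = 2 * 2 from rfl, pow_mul, hu, Real.sq_sqrt (Real.sqrt_nonneg _),
      Real.sq_sqrt (by positivity)]
  have hut : Tendsto u atTop atTop :=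
    Real.tendsto_sqrt_atTop.comp (Real.tendsto_sqrt_atTop.comp
      (tendsto_atTop_add_const_right _ _ tendsto_natCast_atTop_atTop))
  refine squeeze_zero (fun n => tsum_nonneg fun k => abs_nonneg _) (fun n => ?_)
    (hut.const_div_atTop (5 * κ + 2 * K))
  have h1 := hu1 n
  have h0 : 0 < u n := by linarith
  have hR : 0 < ⌈u n ^ 3⌉₊ := Nat.ceil_pos.2 (by positivity)
  refine (tsum_abs_sub_le (hw n) (hδ n) (hV n) hR).trans ?_
  have hl : u n ^ 3 ≤ ⌈u n ^ 3⌉₊ := Nat.le_ceil _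
  have hr : (⌈u n ^ 3⌉₊ : ℝ) < u n ^ 3 + 1 := Nat.ceil_lt_add_one (by positivity)
  have h3 : 1 ≤ u n ^ 3 := one_le_pow₀ h1
  rw [hu4 n]
  generalize (⌈u n ^ 3⌉₊ : ℝ) = R at *
  generalize u n = v at *
  have e1 : (2 * R + 1) * (κ / v ^ 4) ≤ 5 * κ / v := by
    calc (2 * R + 1) * (κ / v ^ 4) ≤ (5 * v ^ 3) * (κ / v ^ 4) := by
          gcongr
          linarith
      _ = 5 * κ / v := by field_simp
  have e2 : 2 * (K * v ^ 4) / R ^ 2 ≤ 2 * K / v := by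
    calc 2 * (K * v ^ 4) / R ^ 2 ≤ 2 * (K * v ^ 4) / (v ^ 3) ^ 2 := by gcongr
      _ = 2 * K / v ^ 2 := by field_simp
      _ ≤ 2 * K / v := by
          gcongr
          nlinarith
  rw [add_div]
  linarith

/-- `|t| e^{-bt²} ≤ 1/√b`. -/
theorem abs_mul_exp_neg_mul_sq_le {b : ℝ} (hb : 0 < b) (t : ℝ) :
    |t| * Real.exp (-b * t ^ 2) ≤ 1 / √b := by
  have hs : 0 < √b := Real.sqrt_pos.2 hb
  have h1 : √b * |t| ≤ Real.exp (b * t ^ 2) := by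
    have h2 := Real.add_one_le_exp (b * t ^ 2)
    have h3 : b * t ^ 2 = (√b * |t|) ^ 2 := by rw [mul_pow, Real.sq_sqrt hb.le, sq_abs]
    rw [h3] at h2 ⊢
    nlinarith [sq_nonneg (√b * |t| - 1)]
  rw [neg_mul, Real.exp_neg, ← div_eq_mul_inv, div_le_div_iff₀ (Real.exp_pos _) hs]
  linarith

theorem expMoment_zero (μ : ℤ → ℝ) (t : ℝ) : expMoment μ 0 t =
    ∑' k : ℤ, (μ k : ℂ) * Complex.exp ((k * t : ℝ) * Complex.I) :=
  tsum_congr fun k => by rw [pow_zero, one_mul, mul_comm]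

theorem hasSum_shift {f : ℤ → ℂ} {a : ℂ} (h : HasSum f a) : HasSum (fun k => f (k - 1)) a :=
  (Equiv.subRight (1 : ℤ)).hasSum_iff.2 h

section LocalLimit

variable {μ : ℤ → ℝ} {b : ℝ}

theorem HasSecondMoment.apply_le (hμ : HasSecondMoment μ) (hb : 0 < b)
    (h : ∀ t : ℝ, |t| ≤ Real.pi → ‖expMoment μ 0 t‖ ≤ Real.exp (-b * t ^ 2)) (k : ℤ) :
    μ k ≤ √(Real.pi / b) := by
  have h1 := norm_coeff_le_of_norm_charSum_le (f := fun k => (μ k : ℂ)) (b := b) (K := 1)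
    (by simpa using (hμ.summable 0 zero_le_two).norm) hb zero_le_one
    (fun t ht => by rw [← expMoment_zero, one_mul]; exact h t ht) k
  rwa [one_mul, Complex.norm_real, Real.norm_of_nonneg (hμ.nonneg k)] at h1

theorem HasSecondMoment.sq_mul_apply_le (hμ : HasSecondMoment μ) {K : ℝ} (hb : 0 < b) (hK : 0 ≤ K)
    (h : ∀ t : ℝ, |t| ≤ Real.pi → ‖expMoment μ 2 t‖ ≤ K * Real.exp (-b * t ^ 2)) (k : ℤ) :
    (k : ℝ) ^ 2 * μ k ≤ K * √(Real.pi / b) := by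
  have h1 := norm_coeff_le_of_norm_charSum_le (f := fun k => (k : ℂ) ^ 2 * (μ k : ℂ)) (b := b)
    (K := K) (by simpa using (hμ.summable 2 le_rfl).norm) hb hK
    (fun t ht => by simpa only [expMoment, mul_right_comm] using h t ht) k
  rwa [norm_mul, norm_pow, Complex.norm_intCast, Complex.norm_real,
    Real.norm_of_nonneg (hμ.nonneg k), sq_abs] at h1

theorem HasSecondMoment.abs_sub_le (hμ : HasSecondMoment μ) (hb : 0 < b)
    (h : ∀ t : ℝ, |t| ≤ Real.pi → ‖expMoment μ 0 t‖ ≤ Real.exp (-(2 * b) * t ^ 2)) (k : ℤ) :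
    |μ (k - 1) - μ k| ≤ √Real.pi / b := by
  have hs : Summable fun k : ℤ => ‖(μ k : ℂ)‖ := by simpa using (hμ.summable 0 zero_le_two).norm
  have hs' : Summable fun k : ℤ => ‖(μ (k - 1) : ℂ)‖ :=
    (Equiv.subRight (1 : ℤ)).summable_iff.2 hs
  have h1 := norm_coeff_le_of_norm_charSum_le (f := fun k => (μ (k - 1) : ℂ) - μ k) (b := b)
    (K := 1 / √b) ((hs'.add hs).of_nonneg_of_le (fun _ => norm_nonneg _) fun _ => norm_sub_le _ _)
    hb (by positivity) (fun t ht => ?_) k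
  · rw [← Complex.ofReal_sub, Complex.norm_real, Real.norm_eq_abs] at h1
    refine h1.trans_eq ?_
    rw [Real.sqrt_div Real.pi_pos.le, div_mul_div_comm, one_mul, Real.mul_self_sqrt hb.le]
  · have g1 : HasSum (fun k : ℤ => (μ k : ℂ) * Complex.exp ((k * t : ℝ) * Complex.I))
        (expMoment μ 0 t) := by
      refine (hμ.hasSum zero_le_two t).congr_fun fun k => ?_
      rw [pow_zero, one_mul, mul_comm]
    have g2 := hasSum_shift g1
    have g3 : HasSum (fun k : ℤ => ((μ (k - 1) : ℂ) - μ k) *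
        Complex.exp ((k * t : ℝ) * Complex.I))
        (expMoment μ 0 t * (Complex.exp (t * Complex.I) - 1)) := by
      rw [mul_sub, mul_one]
      refine ((g2.mul_right _).sub g1).congr_fun fun k => ?_
      rw [sub_mul, mul_assoc, ← Complex.exp_add]
      congr 3
      push_cast
      ring
    rw [g3.tsum_eq, norm_mul]
    have g4 := mul_le_mul (h t ht) (norm_exp_sub_one_le_abs t) (norm_nonneg _) (Real.exp_pos _).le
    refine g4.trans ?_
    have g5 := mul_le_mul_of_nonneg_right (abs_mul_exp_neg_mul_sq_le hb t)
      (Real.exp_pos (-b * t ^ 2)).le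
    refine le_of_eq_of_le ?_ g5
    rw [mul_assoc, ← Real.exp_add, mul_comm]
    congr 2
    ring

end LocalLimit

theorem isPoissonKernelSeq_muN {ν : ℕ → ℤ → ℝ} (hp : ∀ n, IsProbMeasure (ν n))
    (hν : ∀ n, HasSecondMoment (ν n)) (hE : ∀ n, expectation (ν n) = 0) {c K : ℝ} (hc : 0 < c)
    (hchar : ∀ n, ∀ t : ℝ, |t| ≤ Real.pi → ‖expMoment (ν n) 0 t‖ ≤ Real.exp (-c * t ^ 2))
    (hφ : ∀ n : ℕ, ∑ i ∈ Finset.range (n + 1), m2 (ν i) ≤ K * (n + 1)) :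
    ∃ C, IsPoissonKernelSeq (muN ν) C := by
  have hM := HasSecondMoment.muN hν
  have hK : 0 ≤ K := by
    have := (m2_nonneg (hν 0)).trans (by simpa using hφ 0)
    exact this
  have hΦ : ∀ n : ℕ, 0 ≤ ∑ i ∈ Finset.range (n + 1), m2 (ν i) := fun n =>
    Finset.sum_nonneg fun i _ => m2_nonneg (hν i)
  set L : ℝ := Real.exp (2 * c * Real.pi ^ 2) * (K + 2 * K ^ 2 / c) with hL
  have hL0 : 0 ≤ L := by positivity
  have hexp : ∀ (t : ℝ) (n : ℕ), Real.exp (-c * t ^ 2) ^ (n + 1) =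
      Real.exp (-(2 * (c * (n + 1) / 2)) * t ^ 2) := fun t n => by
    rw [← Real.exp_nat_mul]
    congr 1
    push_cast
    ring
  have hle : ∀ t : ℝ, Real.exp (-c * t ^ 2) ≤ 1 := fun t =>
    Real.exp_le_one_iff.2 (by nlinarith [sq_nonneg t])
  have hbpos : ∀ n : ℕ, 0 < c * ((n : ℝ) + 1) / 2 := fun n => by positivity
  have hA : ∀ (n : ℕ) (t : ℝ), |t| ≤ Real.pi →
      ‖expMoment (muN ν n) 0 t‖ ≤ Real.exp (-(2 * (c * (n + 1) / 2)) * t ^ 2) := fun n t ht => by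
    rw [← hexp]
    exact (norm_expMoment_muN_le hν hE (Real.exp_pos _).le (hle t) (fun n => hchar n t ht) n).1
  have hA' : ∀ (n : ℕ) (t : ℝ), |t| ≤ Real.pi →
      ‖expMoment (muN ν n) 0 t‖ ≤ Real.exp (-(c * (n + 1) / 2) * t ^ 2) := fun n t ht =>
    (hA n t ht).trans (Real.exp_le_exp.2 (by nlinarith [mul_nonneg (hbpos n).le (sq_nonneg t)]))
  have hB : ∀ (n : ℕ) (t : ℝ), |t| ≤ Real.pi →
      ‖expMoment (muN ν n) 2 t‖ ≤ L * (n + 1) * Real.exp (-(c * (n + 1) / 2) * t ^ 2) := by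
    intro n t ht
    have h := (norm_expMoment_muN_le hν hE (Real.exp_pos _).le (hle t)
      (fun n => hchar n t ht) n).2.2
    rw [hexp t n] at h
    have hφn := hφ n
    have hΦn := hΦ n
    generalize ∑ i ∈ Finset.range (n + 1), m2 (ν i) = Φ at *
    have hN : (0 : ℝ) < (n : ℝ) + 1 := by positivity
    generalize (n : ℝ) + 1 = N at *
    set x := c * N / 2 * t ^ 2 with hx
    have hx0 : 0 ≤ x := by positivity
    have h1 : Φ + Φ ^ 2 * t ^ 2 ≤ (K + 2 * K ^ 2 / c) * N * Real.exp x := by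
      have h2 : Φ ^ 2 * t ^ 2 ≤ (K * N) ^ 2 * t ^ 2 := by gcongr
      have h3 : (K * N) ^ 2 * t ^ 2 = 2 * K ^ 2 / c * N * x := by
        rw [hx]
        field_simp
      have h4 : 2 * K ^ 2 / c * N * x ≤ 2 * K ^ 2 / c * N * Real.exp x :=
        mul_le_mul_of_nonneg_left (by linarith [Real.add_one_le_exp x]) (by positivity)
      have h5 : K * N * 1 ≤ K * N * Real.exp x :=
        mul_le_mul_of_nonneg_left (Real.one_le_exp hx0) (by positivity)
      linarith
    have h6 : Real.exp (-c * t ^ 2) ^ 2 * Real.exp (2 * c * t ^ 2) = 1 := by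
      rw [← Real.exp_nat_mul, ← Real.exp_add, Real.exp_eq_one_iff]
      push_cast
      ring
    have h7 : Real.exp (2 * c * t ^ 2) ≤ Real.exp (2 * c * Real.pi ^ 2) := by
      have : t ^ 2 ≤ Real.pi ^ 2 := sq_le_sq' (by linarith [(abs_le.1 ht).1]) (abs_le.1 ht).2
      gcongr
    have h8 : Real.exp x * Real.exp (-(2 * (c * N / 2)) * t ^ 2) =
        Real.exp (-(c * N / 2) * t ^ 2) := by
      rw [← Real.exp_add]
      congr 1
      rw [hx]
      ring
    calc ‖expMoment (muN ν n) 2 t‖ = ‖expMoment (muN ν n) 2 t‖ * Real.exp (-c * t ^ 2) ^ 2 *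
          Real.exp (2 * c * t ^ 2) := by rw [mul_assoc, h6, mul_one]
      _ ≤ (K + 2 * K ^ 2 / c) * N * Real.exp x * Real.exp (-(2 * (c * N / 2)) * t ^ 2) *
          Real.exp (2 * c * Real.pi ^ 2) :=
          mul_le_mul (h.trans (mul_le_mul_of_nonneg_right h1 (Real.exp_pos _).le)) h7
            (Real.exp_pos _).le (by positivity)
      _ = L * N * (Real.exp x * Real.exp (-(2 * (c * N / 2)) * t ^ 2)) := by rw [hL]; ring
      _ = L * N * Real.exp (-(c * N / 2) * t ^ 2) := by rw [h8]
  have hroot : ∀ n : ℕ, √(Real.pi / (c * ((n : ℝ) + 1) / 2)) =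
      √(2 * Real.pi / c) / √((n : ℝ) + 1) := fun n => by
    rw [← Real.sqrt_div (by positivity)]
    congr 1
    field_simp
  set q := √(2 * Real.pi / c) with hq
  have hq0 : 0 ≤ q := Real.sqrt_nonneg _
  refine ⟨2 * (q + L * q), ⟨fun n => (hM n).nonneg, fun n => (IsProbMeasure.muN hp hν n).2,
    by positivity, fun n => ⟨√((n : ℝ) + 1), ?_, fun k => ?_⟩, ?_⟩⟩
  · rw [Real.one_le_sqrt]
    linarith [(Nat.cast_nonneg n : (0 : ℝ) ≤ n)]
  · have h1 := (hM n).apply_le (hbpos n) (hA' n) k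
    have h2 := (hM n).sq_mul_apply_le (hbpos n) (by positivity) (hB n) k
    rw [hroot] at h1 h2
    have hs : 0 < √((n : ℝ) + 1) := Real.sqrt_pos.2 (by positivity)
    have hN : (n : ℝ) + 1 = √((n : ℝ) + 1) ^ 2 := (Real.sq_sqrt (by positivity)).symm
    rw [show L * ((n : ℝ) + 1) * (q / √((n : ℝ) + 1)) = L * q * √((n : ℝ) + 1) by
      nth_rewrite 1 [hN]
      field_simp] at h2
    generalize √((n : ℝ) + 1) = s at *
    rw [le_div_iff₀ hs] at h1
    have hk := (hM n).nonneg k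
    generalize muN ν n k = w at *
    rw [← mul_div_assoc, le_div_iff₀ (by positivity)]
    have h3 : (s + |(k : ℝ)|) ^ 2 ≤ 2 * (s ^ 2 + (k : ℝ) ^ 2) := by
      rw [← sq_abs (k : ℝ)]
      nlinarith [sq_nonneg (s - |(k : ℝ)|)]
    have h4 := mul_le_mul_of_nonneg_left h3 hk
    have h5 := mul_le_mul_of_nonneg_right h1 hs.le
    linarith
  · refine tendsto_tsum_abs_sub hM (κ := 2 * √Real.pi / c) (by positivity) hK (fun n k => ?_)
      fun n => (m2_muN_le hp hν hE n).trans (hφ n)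
    refine ((hM n).abs_sub_le (hbpos n) (hA n) k).trans_eq ?_
    field_simp

end Convolutions

/-- Theorem 3.4: if the probability measures `ν_n` on `ℤ` have zero
expectation, uniformly bounded first moments, mass at most `ρ < 1` on every proper coset,
and `φ(n) = ∑_{i=0}^n m₂(ν_i) = O(n)`, then for every invertible measure-preserving
transformation of a probability space and every `f ∈ L¹`, the averages
`μ_n f(x) = ∑_k μ_n(k) f(τ^k x)` with `μ_n = ν_0 ∗ ⋯ ∗ ν_n` converge a.e. -/
theorem ae_convergence_uniform_moments
    (ν : ℕ → ℤ → ℝ) (a ρ : ℝ) (ha : 0 < a) (hρ1 : ρ < 1)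
    (hprob : ∀ n, IsProbMeasure (ν n))
    (hE : ∀ n, expectation (ν n) = 0)
    (hm1 : ∀ n, Summable fun k : ℤ => |(k : ℝ)| * ν n k)
    (hm1a : ∀ n, m1 (ν n) ≤ a)
    (hcoset : ∀ n, ∀ β r : ℤ, β.natAbs ≠ 1 → cosetMass (ν n) β r ≤ ρ)
    (hm2 : ∀ n, Summable fun k : ℤ => |(k : ℝ)| ^ 2 * ν n k)
    (hφ : ∃ K : ℝ, ∀ n : ℕ, ∑ i ∈ Finset.range (n + 1), m2 (ν i) ≤ K * (n + 1)) :
    ∀ (X : Type) [MeasurableSpace X] (m : Measure X), IsProbabilityMeasure m →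
      ∀ τ : Equiv.Perm X, Measurable (τ : X → X) → Measurable (τ.symm : X → X) →
        MeasurePreserving (τ : X → X) m m →
        ∀ f : X → ℝ, Integrable f m →
          ∀ᵐ x ∂m, ∃ L : ℝ,
            Filter.Tendsto (fun n => ∑' k : ℤ, muN ν n k * f ((τ ^ k) x))
              Filter.atTop (nhds L) := by
  intro X _ m hm τ hτm hτm' hτ f hf
  have hτ' : MeasurePreserving τ.symm m m :=
    MeasurePreserving.symm (MeasurableEquiv.mk τ hτm hτm') hτ
  have hν : ∀ n, HasSecondMoment (ν n) := fun n => (hprob n).hasSecondMoment (hm1 n) (hm2 n)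
  obtain ⟨c, hc, hchar⟩ := exists_norm_charSum_le a ρ ha hρ1
  obtain ⟨K, hK⟩ := hφ
  obtain ⟨C, hC⟩ := isPoissonKernelSeq_muN hprob hν hE hc (fun n t ht => by
    rw [expMoment_zero]
    exact hchar (ν n) (hprob n) (hm1 n) (hm1a n) (hcoset n) t ht) hK
  exact hC.aeConverges hτ hτ' hf
end

section
/- Let (ν_l) be probability measures on ℤ of the form ν_l = a_l δ_{x_l} + (1 − a_l) γ_l, where 1/2 < a_l ≤ 1, x_l ∈ ℤ, and each γ_l is a probability measure on ℤ. Then for every n and every t ∈ [−1/2, 1/2), the Fourier transform of μ_n = ν_1∗⋯∗ν_n satisfies |μ̂_n(t)| ≥ ∏_{l=1}^n (2a_l − 1); in particular, if ∑_l (1 − a_l) < ∞ then there is a constant c > 0 such that |μ̂_n(t)| ≥ c for all n and all t. -/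
open scoped BigOperators
open Filter MeasureTheory

theorem norm_ofReal_mul_exp (c : ℝ) (k : ℤ) (t : ℝ) :
    ‖(c : ℂ) * Complex.exp (2 * Real.pi * Complex.I * (k : ℂ) * (t : ℂ))‖ = |c| := by
  have h : (2 * Real.pi * Complex.I * (k : ℂ) * (t : ℂ)) =
      ((2 * Real.pi * k * t : ℝ) : ℂ) * Complex.I := by
    push_cast
    ring
  rw [norm_mul, h, Complex.norm_exp_ofReal_mul_I, mul_one, Complex.norm_real, Real.norm_eq_abs]

theorem summable_norm_ft {ν : ℤ → ℝ} (hν : Summable ν) (t : ℝ) :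
    Summable fun k : ℤ =>
      ‖(ν k : ℂ) * Complex.exp (2 * Real.pi * Complex.I * (k : ℂ) * (t : ℂ))‖ := by
  simpa only [norm_ofReal_mul_exp] using hν.abs

/-- The shear `(k, j) ↦ (k - j, j)` of `ℤ × ℤ`. -/
def shearEquiv : ℤ × ℤ ≃ ℤ × ℤ where
  toFun p := (p.1 - p.2, p.2)
  invFun p := (p.1 + p.2, p.2)
  left_inv p := by simp
  right_inv p := by simp

theorem summable_conv {μ ν : ℤ → ℝ} (hμ : Summable μ) (hν : Summable ν) :
    Summable (conv μ ν) := by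
  have h : Summable fun p : ℤ × ℤ => μ p.1 * ν p.2 :=
    summable_mul_of_summable_norm hμ.norm hν.norm
  exact (shearEquiv.summable_iff.mpr h).prod

theorem ft_conv {μ ν : ℤ → ℝ} (hμ : Summable μ) (hν : Summable ν) (t : ℝ) :
    ft (conv μ ν) t = ft μ t * ft ν t := by
  have hμ' := summable_norm_ft hμ t
  have hν' := summable_norm_ft hν t
  have h := shearEquiv.summable_iff.mpr (summable_mul_of_summable_norm hμ' hν')
  unfold ft
  rw [tsum_mul_tsum_of_summable_norm hμ' hν', ← shearEquiv.tsum_eq]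
  refine Eq.trans ?_ h.tsum_prod.symm
  refine tsum_congr fun k => ?_
  rw [conv, Complex.ofReal_tsum, ← tsum_mul_right]
  refine tsum_congr fun j => ?_
  have hexp : (2 * Real.pi * Complex.I * (k : ℂ) * (t : ℂ)) =
      2 * Real.pi * Complex.I * ((k - j : ℤ) : ℂ) * (t : ℂ) +
        2 * Real.pi * Complex.I * (j : ℂ) * (t : ℂ) := by
    push_cast
    ring
  rw [hexp, Complex.exp_add]
  simp only [Function.comp_apply, shearEquiv, Equiv.coe_fn_mk, Complex.ofReal_mul]
  ring

theorem summable_muN {ν : ℕ → ℤ → ℝ} (hν : ∀ l, Summable (ν l)) (n : ℕ) :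
    Summable (muN ν n) := by
  induction n with
  | zero => exact hν 0
  | succ n ih => exact summable_conv ih (hν (n + 1))

theorem ft_muN {ν : ℕ → ℤ → ℝ} (hν : ∀ l, Summable (ν l)) (n : ℕ) (t : ℝ) :
    ft (muN ν n) t = ∏ l ∈ Finset.range (n + 1), ft (ν l) t := by
  induction n with
  | zero => simp [muN]
  | succ n ih =>
    rw [Finset.prod_range_succ, ← ih, muN, ft_conv (summable_muN hν n) (hν (n + 1))]

theorem IsProbMeasure.norm_ft_le_one {γ : ℤ → ℝ} (hγ : IsProbMeasure γ) (t : ℝ) :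
    ‖ft γ t‖ ≤ 1 := by
  refine tsum_of_norm_bounded hγ.2 fun k => ?_
  rw [norm_ofReal_mul_exp, abs_of_nonneg (hγ.1 k)]

theorem hasSum_of_eq_ite_add {ν γ : ℤ → ℝ} {a : ℝ} {x : ℤ} (hγ : IsProbMeasure γ)
    (hν : ∀ k, ν k = (if k = x then a else 0) + (1 - a) * γ k) : HasSum ν 1 := by
  have h := (hasSum_ite_eq x a).add (hγ.2.mul_left (1 - a))
  rw [mul_one, add_sub_cancel] at h
  rwa [funext hν]

theorem two_mul_sub_one_le_norm_ft {ν γ : ℤ → ℝ} {a : ℝ} {x : ℤ} (ha : a ≤ 1)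
    (hγ : IsProbMeasure γ) (hν : ∀ k, ν k = (if k = x then a else 0) + (1 - a) * γ k)
    (t : ℝ) : 2 * a - 1 ≤ ‖ft ν t‖ := by
  set e : ℤ → ℂ := fun k => Complex.exp (2 * Real.pi * Complex.I * (k : ℂ) * (t : ℂ)) with he
  have h := (hasSum_ite_eq x ((a : ℂ) * e x)).add
    ((summable_norm_ft hγ.2.summable t).of_norm.hasSum.mul_left ((1 - a : ℝ) : ℂ))
  have hft : ft ν t = (a : ℂ) * e x + ((1 - a : ℝ) : ℂ) * ft γ t := by
    rw [ft, ft, ← h.tsum_eq]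
    refine tsum_congr fun k => ?_
    rw [hν k]
    split_ifs with hk
    · subst hk
      simp only [he]
      push_cast
      ring
    · push_cast
      ring
  have hmain : a ≤ ‖(a : ℂ) * e x‖ := by
    rw [norm_ofReal_mul_exp]
    exact le_abs_self a
  have hrest : ‖((1 - a : ℝ) : ℂ) * ft γ t‖ ≤ 1 - a := by
    rw [norm_mul, Complex.norm_real, Real.norm_of_nonneg (sub_nonneg.mpr ha)]
    exact mul_le_of_le_one_right (sub_nonneg.mpr ha) (hγ.norm_ft_le_one t)
  have htri := norm_sub_le_norm_add ((a : ℂ) * e x) (((1 - a : ℝ) : ℂ) * ft γ t)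
  rw [hft]
  linarith

theorem exists_pos_le_prod_one_sub {b : ℕ → ℝ} (hb0 : ∀ l, 0 ≤ b l) (hb1 : ∀ l, b l < 1)
    (hb : Summable b) : ∃ c : ℝ, 0 < c ∧ ∀ n, c ≤ ∏ l ∈ Finset.range n, (1 - b l) := by
  have hlog : Summable fun l => -Real.log (1 - b l) := by
    simpa only [sub_eq_add_neg] using (Real.summable_log_one_add_of_summable hb.neg).neg
  refine ⟨Real.exp (-∑' l, -Real.log (1 - b l)), Real.exp_pos _, fun n => ?_⟩
  have hpos : ∀ l, 0 < 1 - b l := fun l => sub_pos.mpr (hb1 l)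
  rw [← Real.exp_log (Finset.prod_pos fun l (_ : l ∈ Finset.range n) => hpos l),
    Real.log_prod fun l _ => (hpos l).ne', Real.exp_le_exp, neg_le, ← Finset.sum_neg_distrib]
  refine hlog.sum_le_tsum _ fun l _ => neg_nonneg.mpr ?_
  exact Real.log_nonpos (hpos l).le (sub_le_self _ (hb0 l))

/-- if `ν_l = a_l δ_{x_l} + (1 - a_l) γ_l` with `1/2 < a_l ≤ 1`, then
`|μ̂_n(t)| ≥ ∏_{l=0}^n (2a_l - 1)` for all `n` and `t ∈ [-1/2, 1/2)`, where
`μ_n = ν_0 ∗ ⋯ ∗ ν_n`; in particular, if `∑ (1 - a_l) < ∞` then `|μ̂_n(t)| ≥ c` for some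
`c > 0`, uniformly in `n` and `t`. -/
theorem fourier_conv_lower_bound
    (ν γ : ℕ → ℤ → ℝ) (a : ℕ → ℝ) (x : ℕ → ℤ)
    (ha : ∀ l, 1 / 2 < a l ∧ a l ≤ 1)
    (hγ : ∀ l, IsProbMeasure (γ l))
    (hν : ∀ l k, ν l k = (if k = x l then a l else 0) + (1 - a l) * γ l k) :
    (∀ n : ℕ, ∀ t ∈ Set.Ico (-(1 : ℝ) / 2) (1 / 2),
      (∏ l ∈ Finset.range (n + 1), (2 * a l - 1)) ≤ ‖ft (muN ν n) t‖) ∧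
    ((Summable fun l => 1 - a l) →
      ∃ c : ℝ, 0 < c ∧ ∀ n : ℕ, ∀ t ∈ Set.Ico (-(1 : ℝ) / 2) (1 / 2),
        c ≤ ‖ft (muN ν n) t‖) := by
  have hsum : ∀ l, Summable (ν l) := fun l => (hasSum_of_eq_ite_add (hγ l) (hν l)).summable
  have hbound : ∀ n t, (∏ l ∈ Finset.range (n + 1), (2 * a l - 1)) ≤ ‖ft (muN ν n) t‖ := by
    intro n t
    rw [ft_muN hsum, norm_prod]
    refine Finset.prod_le_prod (fun l _ => by linarith [(ha l).1]) fun l _ => ?_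
    exact two_mul_sub_one_le_norm_ft (ha l).2 (hγ l) (hν l) t
  refine ⟨fun n t _ => hbound n t, fun hs => ?_⟩
  obtain ⟨c, hc, hle⟩ := exists_pos_le_prod_one_sub (b := fun l => 2 * (1 - a l))
    (fun l => by linarith [(ha l).2]) (fun l => by linarith [(ha l).1]) (hs.mul_left 2)
  refine ⟨c, hc, fun n t _ => (hle (n + 1)).trans (le_of_eq_of_le ?_ (hbound n t))⟩
  exact Finset.prod_congr rfl fun l _ => by ring
end
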